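/- arXiv:1002.0384 — 5 statements merged into one kernel-verified Lean document; each statement's English description precedes it below -/
import Mathlib

section
/- Let (n, ⟨·,·⟩₁) be a nilsoliton with Ric₁ = cI + D₁, c < 0, and let a and a' be two abelian Lie algebras of ⟨·,·⟩₁-symmetric derivations of n. Let (s, ⟨·,·⟩) and (s', ⟨·,·⟩') be the solsolitons obtained from (n, ⟨·,·⟩₁) together with a and a', respectively, via the standard construction. Then there exists a Lie algebra isomorphism f : s → s' with ⟨f(X), f(Y)⟩' = ⟨X, Y⟩ for all X, Y (i.e. the two solsolitons are isometric) if and only if there exists h ∈ Aut(n) ∩ O(n, ⟨·,·⟩₁) such that a' = h a h⁻¹. -/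
noncomputable section

open scoped RealInnerProductSpace

/-! ### Lie-algebraic notions for a bracket given as a bundled bilinear map -/

section Alg

variable {E : Type*} [AddCommGroup E] [Module ℝ E]

/-- `μ` is a Lie bracket: alternating and satisfying the (Leibniz form of the) Jacobi identity. -/
def IsLieBracket (μ : E →ₗ[ℝ] E →ₗ[ℝ] E) : Prop :=
  (∀ X, μ X X = 0) ∧ ∀ X Y Z, μ X (μ Y Z) = μ (μ X Y) Z + μ Y (μ X Z)

/-- `D` is a derivation of the algebra `(E, μ)`. -/
def IsDeriv (μ : E →ₗ[ℝ] E →ₗ[ℝ] E) (D : E →ₗ[ℝ] E) : Prop :=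
  ∀ X Y, D (μ X Y) = μ (D X) Y + μ X (D Y)

/-- The subspace spanned by brackets of elements of `p` and `q`. -/
def bracketSpan (μ : E →ₗ[ℝ] E →ₗ[ℝ] E) (p q : Submodule ℝ E) : Submodule ℝ E :=
  Submodule.span ℝ {z | ∃ x ∈ p, ∃ y ∈ q, μ x y = z}

/-- Derived series of `(E, μ)`. -/
def derSeries (μ : E →ₗ[ℝ] E →ₗ[ℝ] E) : ℕ → Submodule ℝ E
  | 0 => ⊤
  | k + 1 => bracketSpan μ (derSeries μ k) (derSeries μ k)

/-- `(E, μ)` is a solvable Lie algebra. -/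
def IsSolvableB (μ : E →ₗ[ℝ] E →ₗ[ℝ] E) : Prop := ∃ k, derSeries μ k = ⊥

/-- Lower central series of the subalgebra `p` of `(E, μ)`. -/
def lcsOn (μ : E →ₗ[ℝ] E →ₗ[ℝ] E) (p : Submodule ℝ E) : ℕ → Submodule ℝ E
  | 0 => p
  | k + 1 => bracketSpan μ p (lcsOn μ p k)

/-- The subalgebra `p` of `(E, μ)` is a nilpotent Lie algebra. -/
def IsNilpotentOn (μ : E →ₗ[ℝ] E →ₗ[ℝ] E) (p : Submodule ℝ E) : Prop := ∃ k, lcsOn μ p k = ⊥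

/-- `p` is an ideal of `(E, μ)`. -/
def IsIdeal (μ : E →ₗ[ℝ] E →ₗ[ℝ] E) (p : Submodule ℝ E) : Prop := ∀ X : E, ∀ Y ∈ p, μ X Y ∈ p

/-- `p` is the nilradical (maximal nilpotent ideal) of `(E, μ)`. -/
def IsNilradical (μ : E →ₗ[ℝ] E →ₗ[ℝ] E) (p : Submodule ℝ E) : Prop :=
  IsIdeal μ p ∧ IsNilpotentOn μ p ∧ ∀ q, IsIdeal μ q → IsNilpotentOn μ q → q ≤ p

/-- The natural action `π(f)μ` of `f ∈ End(E)` on bilinear maps: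
`(π(f)μ)(X,Y) = f(μ(X,Y)) - μ(fX,Y) - μ(X,fY)`. -/
def piAct (f : E →ₗ[ℝ] E) (μ : E →ₗ[ℝ] E →ₗ[ℝ] E) : E →ₗ[ℝ] E →ₗ[ℝ] E :=
  (LinearMap.llcomp ℝ E E E f) ∘ₗ μ - μ ∘ₗ f - (LinearMap.lcomp ℝ E f) ∘ₗ μ

/-- The center of `(E, μ)`. -/
def centerB (μ : E →ₗ[ℝ] E →ₗ[ℝ] E) : Submodule ℝ E where
  carrier := {X | μ X = 0}
  add_mem' := by intro a b ha hb; simp only [Set.mem_setOf_eq, map_add] at *; rw [ha, hb, add_zero]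
  zero_mem' := by simp only [Set.mem_setOf_eq, map_zero]
  smul_mem' := by intro c a ha; simp only [Set.mem_setOf_eq, map_smul] at *; rw [ha, smul_zero]

end Alg

/-! ### Metric notions -/

section MetricDefs

variable {E : Type*} [NormedAddCommGroup E] [InnerProductSpace ℝ E] [FiniteDimensional ℝ E]

/-- The transpose of an operator with respect to the inner product. -/
def transp (f : E →ₗ[ℝ] E) : E →ₗ[ℝ] E := LinearMap.adjoint f

/-- The symmetric part `S(f) = (f + fᵗ)/2` of an operator. -/
def symPart (f : E →ₗ[ℝ] E) : E →ₗ[ℝ] E := (1 / 2 : ℝ) • (f + transp f)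

variable (E) in
/-- A fixed orthonormal basis of `E`. -/
def stdONB : OrthonormalBasis (Fin (Module.finrank ℝ E)) ℝ E := stdOrthonormalBasis ℝ E

/-- The operator `R` appearing in the formula for the Ricci operator of a metric Lie algebra:
`⟨R X, X⟩ = -(1/2) Σ ⟨[X,Xᵢ],Xⱼ⟩² + (1/4) Σ ⟨[Xᵢ,Xⱼ],X⟩²` for any orthonormal basis `{Xᵢ}`. -/
def Rop (μ : E →ₗ[ℝ] E →ₗ[ℝ] E) : E →ₗ[ℝ] E :=
  (-(1 / 2 : ℝ)) • ∑ i, (transp (μ (stdONB E i))) ∘ₗ (μ (stdONB E i))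
    + (1 / 4 : ℝ) • ∑ i, (μ (stdONB E i)) ∘ₗ (transp (μ (stdONB E i)))

/-- The symmetric operator `B` defined by the Killing form: `⟨B X, X⟩ = tr((ad X)²)`. -/
def Bop (μ : E →ₗ[ℝ] E →ₗ[ℝ] E) : E →ₗ[ℝ] E :=
  ∑ i, (((LinearMap.trace ℝ E) ∘ₗ (LinearMap.lcomp ℝ E (μ (stdONB E i))) ∘ₗ μ).smulRight
    (stdONB E i))

/-- The mean curvature vector `H`, characterized by `⟨H, X⟩ = tr (ad X)`. -/
def meanCurv (μ : E →ₗ[ℝ] E →ₗ[ℝ] E) : E :=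
  ∑ i, (LinearMap.trace ℝ E (μ (stdONB E i))) • (stdONB E i : E)

/-- The Ricci operator `Ric = R - (1/2) B - S(ad H)` of a metric Lie algebra. -/
def Ric (μ : E →ₗ[ℝ] E →ₗ[ℝ] E) : E →ₗ[ℝ] E :=
  Rop μ - (1 / 2 : ℝ) • Bop μ - symPart (μ (meanCurv μ))

/-- `(E, μ, ⟨⬝,⬝⟩)` is a solsoliton: `Ric = c I + D` for some `c ∈ ℝ` and derivation `D`. -/
def IsSolsoliton (μ : E →ₗ[ℝ] E →ₗ[ℝ] E) : Prop :=
  ∃ (c : ℝ) (D : E →ₗ[ℝ] E), IsDeriv μ D ∧ Ric μ = c • LinearMap.id + D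

/-- The natural inner product on bilinear maps, `⟨μ,ν⟩ = Σ ⟨μ(Xᵢ,Xⱼ), ν(Xᵢ,Xⱼ)⟩`. -/
def binner (μ ν : E →ₗ[ℝ] E →ₗ[ℝ] E) : ℝ :=
  ∑ i, ∑ j, ⟪μ (stdONB E i) (stdONB E j), ν (stdONB E i) (stdONB E j)⟫

/-- Orthogonal projection onto a subspace, as an endomorphism of `E`. -/
def projL (p : Submodule ℝ E) : E →ₗ[ℝ] E :=
  p.subtype ∘ₗ (Submodule.orthogonalProjection p).toLinearMap

/-- An orthonormal basis of the subspace `p`, as a family of vectors of `E`. -/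
def onbOf (p : Submodule ℝ E) : Fin (Module.finrank ℝ ↥p) → E :=
  fun i => ((stdOrthonormalBasis ℝ ↥p) i : E)

/-- The restriction `ad X |_p` of `ad X` to the subspace `p`, as an endomorphism of `E`
(it kills `pᗮ`). -/
def adOn (μ : E →ₗ[ℝ] E →ₗ[ℝ] E) (p : Submodule ℝ E) (X : E) : E →ₗ[ℝ] E :=
  (μ X) ∘ₗ projL p

/-- The Ricci operator of the restricted metric Lie algebra `(p, μ|ₚ, ⟨⬝,⬝⟩|ₚ)`, for `p` a
bracket-closed subspace, realized as an endomorphism of `E` killing `pᗮ`.  (For `p` nilpotent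
this is the full Ricci operator of `p`.) -/
def RopOn (μ : E →ₗ[ℝ] E →ₗ[ℝ] E) (p : Submodule ℝ E) : E →ₗ[ℝ] E :=
  (-(1 / 2 : ℝ)) • ∑ i, (transp (adOn μ p (onbOf p i))) ∘ₗ (adOn μ p (onbOf p i))
    + (1 / 4 : ℝ) • ∑ i, (adOn μ p (onbOf p i)) ∘ₗ (transp (adOn μ p (onbOf p i)))

/-- The metric nilpotent Lie algebra `(p, μ|ₚ, ⟨⬝,⬝⟩|ₚ)` is a nilsoliton with Ricci operator
`c I + D₁`, where `D₁` is (induced by) a derivation of `p`. -/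
def IsNilsolitonOn (μ : E →ₗ[ℝ] E →ₗ[ℝ] E) (p : Submodule ℝ E) (c : ℝ) (D₁ : E →ₗ[ℝ] E) :
    Prop :=
  (∀ X ∈ p, D₁ X ∈ p) ∧ (∀ X ∈ p, ∀ Y ∈ p, D₁ (μ X Y) = μ (D₁ X) Y + μ X (D₁ Y)) ∧
    ∀ X ∈ p, RopOn μ p X = c • X + D₁ X

end MetricDefs

section Construction

variable (N : Type*) [NormedAddCommGroup N] [InnerProductSpace ℝ N] [FiniteDimensional ℝ N]
variable (E : Type*) [NormedAddCommGroup E] [InnerProductSpace ℝ E] [FiniteDimensional ℝ E]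

/-- `(E, μE, ⟨⬝,⬝⟩)` is (isometrically identified via `φ` with) the solsoliton obtained from the
metric nilpotent Lie algebra `(N, μN, ⟨⬝,⬝⟩₁)` and the abelian algebra `a` of symmetric
derivations of `N` by the standard construction: `φ` identifies `N` isometrically and
Lie-isomorphically with the nilradical `n` of `E`, `a = nᗮ` is abelian, the operators
`ad A|ₙ`, `A ∈ nᗮ`, correspond exactly to the elements of `a` under `φ`, and
`⟨A, A'⟩ = -(1/c)·tr (ad A ∘ ad A')`. -/
def IsStdConstruction (μN : N →ₗ[ℝ] N →ₗ[ℝ] N) (c : ℝ) (a : Submodule ℝ (N →ₗ[ℝ] N))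
    (μE : E →ₗ[ℝ] E →ₗ[ℝ] E) (n : Submodule ℝ E) (φ : N →ₗ[ℝ] E) : Prop :=
  IsLieBracket μE ∧ IsSolvableB μE ∧ IsNilradical μE n ∧
    (∀ X Y : N, ⟪φ X, φ Y⟫ = ⟪X, Y⟫) ∧ (∀ X Y : N, φ (μN X Y) = μE (φ X) (φ Y)) ∧
    LinearMap.range φ = n ∧
    (∀ A ∈ nᗮ, ∀ A' ∈ nᗮ, μE A A' = 0) ∧
    (∀ A ∈ nᗮ, ∃ T ∈ a, ∀ X : N, μE A (φ X) = φ (T X)) ∧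
    (∀ T ∈ a, ∃ A ∈ nᗮ, ∀ X : N, μE A (φ X) = φ (T X)) ∧
    (∀ A ∈ nᗮ, ∀ A' ∈ nᗮ,
      ⟪A, A'⟫ = -(1 / c) * LinearMap.trace ℝ E ((μE A) ∘ₗ (μE A')))

end Construction

section Transport

variable {E E' : Type*} [AddCommGroup E] [Module ℝ E] [AddCommGroup E'] [Module ℝ E']
  {μ : E →ₗ[ℝ] E →ₗ[ℝ] E} {μ' : E' →ₗ[ℝ] E' →ₗ[ℝ] E'} {f : E ≃ₗ[ℝ] E'}

theorem map_bracketSpan (hf : ∀ X Y, f (μ X Y) = μ' (f X) (f Y)) (p q : Submodule ℝ E) :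
    (bracketSpan μ p q).map f.toLinearMap =
      bracketSpan μ' (p.map f.toLinearMap) (q.map f.toLinearMap) := by
  unfold bracketSpan
  rw [Submodule.map_span]
  congr 1
  ext z
  constructor
  · rintro ⟨_, ⟨x, hx, y, hy, rfl⟩, rfl⟩
    exact ⟨f x, ⟨x, hx, rfl⟩, f y, ⟨y, hy, rfl⟩, (hf x y).symm⟩
  · rintro ⟨_, ⟨x, hx, rfl⟩, _, ⟨y, hy, rfl⟩, rfl⟩
    exact ⟨μ x y, ⟨x, hx, y, hy, rfl⟩, hf x y⟩

theorem map_lcsOn (hf : ∀ X Y, f (μ X Y) = μ' (f X) (f Y)) (p : Submodule ℝ E) (k : ℕ) :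
    (lcsOn μ p k).map f.toLinearMap = lcsOn μ' (p.map f.toLinearMap) k := by
  induction k with
  | zero => rfl
  | succ k ih => rw [lcsOn, lcsOn, map_bracketSpan hf, ih]

theorem IsNilpotentOn.map (hf : ∀ X Y, f (μ X Y) = μ' (f X) (f Y)) {p : Submodule ℝ E}
    (hp : IsNilpotentOn μ p) : IsNilpotentOn μ' (p.map f.toLinearMap) := by
  obtain ⟨k, hk⟩ := hp
  exact ⟨k, by rw [← map_lcsOn hf, hk, Submodule.map_bot]⟩

theorem IsIdeal.map (hf : ∀ X Y, f (μ X Y) = μ' (f X) (f Y)) {p : Submodule ℝ E}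
    (hp : IsIdeal μ p) : IsIdeal μ' (p.map f.toLinearMap) := by
  rintro X _ ⟨y, hy, rfl⟩
  exact ⟨μ (f.symm X) y, hp _ y hy, by simp [hf]⟩

theorem symm_map_bracket (hf : ∀ X Y, f (μ X Y) = μ' (f X) (f Y)) (X Y : E') :
    f.symm (μ' X Y) = μ (f.symm X) (f.symm Y) := by
  rw [LinearEquiv.symm_apply_eq, hf, f.apply_symm_apply, f.apply_symm_apply]

/-- A Lie algebra isomorphism maps the nilradical onto the nilradical. -/
theorem IsNilradical.map_eq (hf : ∀ X Y, f (μ X Y) = μ' (f X) (f Y)) {n : Submodule ℝ E}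
    {n' : Submodule ℝ E'} (hn : IsNilradical μ n) (hn' : IsNilradical μ' n') :
    n.map f.toLinearMap = n' := by
  refine le_antisymm (hn'.2.2 _ (hn.1.map hf) (hn.2.1.map hf)) fun X hX => ?_
  have hle := hn.2.2 _ (hn'.1.map (symm_map_bracket hf)) (hn'.2.1.map (symm_map_bracket hf))
  exact ⟨f.symm X, hle ⟨X, hX, rfl⟩, f.apply_symm_apply X⟩

end Transport

theorem IsLieBracket.skew {E : Type*} [AddCommGroup E] [Module ℝ E]
    {μ : E →ₗ[ℝ] E →ₗ[ℝ] E} (hμ : IsLieBracket μ) (X Y : E) : μ X Y = -μ Y X := by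
  have h := hμ.1 (X + Y)
  simp only [map_add, LinearMap.add_apply, hμ.1, zero_add, add_zero] at h
  exact eq_neg_of_add_eq_zero_right h

section StdConstruction

variable {N : Type*} [NormedAddCommGroup N] [InnerProductSpace ℝ N]
  {E : Type*} [NormedAddCommGroup E] [InnerProductSpace ℝ E]

theorem injective_of_inner_map {φ : N →ₗ[ℝ] E} (hφ : ∀ X Y, ⟪φ X, φ Y⟫ = ⟪X, Y⟫) :
    Function.Injective φ := by
  refine (injective_iff_map_eq_zero φ).2 fun X hX => ?_
  rw [← inner_self_eq_zero (𝕜 := ℝ), ← hφ, hX, inner_zero_left]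

theorem map_mem_orthogonal {n : Submodule ℝ N} {n' : Submodule ℝ E} (f : N ≃ₗ[ℝ] E)
    (hf : ∀ X Y, ⟪f X, f Y⟫ = ⟪X, Y⟫) (hn : n.map f.toLinearMap = n') {A : N} (hA : A ∈ nᗮ) :
    f A ∈ n'ᗮ := by
  subst hn
  rintro _ ⟨x, hx, rfl⟩
  exact (hf x A).trans (hA x hx)

variable [FiniteDimensional ℝ N] [FiniteDimensional ℝ E]
  {μN : N →ₗ[ℝ] N →ₗ[ℝ] N} {c : ℝ} {a : Submodule ℝ (N →ₗ[ℝ] N)}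
  {μE : E →ₗ[ℝ] E →ₗ[ℝ] E} {n : Submodule ℝ E} {φ : N →ₗ[ℝ] E}

theorem IsStdConstruction.map_mem (hE : IsStdConstruction N E μN c a μE n φ) (X : N) :
    φ X ∈ n := by
  rw [← hE.2.2.2.2.2.1]
  exact LinearMap.mem_range_self φ X

/-- An element of `nᗮ` is determined by its adjoint action on `n`. -/
theorem IsStdConstruction.eq_zero_of_ad_eq_zero (hE : IsStdConstruction N E μN c a μE n φ)
    {A : E} (hA : A ∈ nᗮ) (h : ∀ X, μE A (φ X) = 0) : A = 0 := by
  obtain ⟨-, -, -, -, -, hr, hab, -, -, htr⟩ := hE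
  have had : μE A = 0 := by
    ext Z
    obtain ⟨y, hy, z, hz, rfl⟩ := n.exists_add_mem_mem_orthogonal Z
    rw [← hr] at hy
    obtain ⟨X, rfl⟩ := hy
    simp [h X, hab A hA z hz]
  rw [← inner_self_eq_zero (𝕜 := ℝ), htr A hA A hA, had]
  simp

/-- The standard construction identifies `N × a` with `E`. -/
theorem IsStdConstruction.exists_prodEquiv (hE : IsStdConstruction N E μN c a μE n φ) :
    ∃ Ψ : (N × a) ≃ₗ[ℝ] E, (∀ X, Ψ (X, 0) = φ X) ∧ (∀ T, Ψ (0, T) ∈ nᗮ) ∧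
      ∀ (T : a) (X : N), μE (Ψ (0, T)) (φ X) = φ ((T : N →ₗ[ℝ] N) X) := by
  have hmem := hE.map_mem
  have hzero := fun A hA => hE.eq_zero_of_ad_eq_zero (A := A) hA
  obtain ⟨-, -, -, hφ, -, hr, -, hT, hA, -⟩ := hE
  have hinj := injective_of_inner_map hφ
  choose α hα hαφ using fun T : a => hA T T.2
  have huniq : ∀ (T : a), ∀ A ∈ nᗮ, (∀ X, μE A (φ X) = φ ((T : N →ₗ[ℝ] N) X)) → A = α T := by
    intro T A hA h
    exact sub_eq_zero.1 (hzero _ (nᗮ.sub_mem hA (hα T)) fun X => by simp [h, hαφ])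
  let αL : a →ₗ[ℝ] E :=
    { toFun := α
      map_add' := fun S T => (huniq _ _ (nᗮ.add_mem (hα S) (hα T)) fun X => by
        simp [hαφ]).symm
      map_smul' := fun r T => (huniq _ _ (nᗮ.smul_mem r (hα T)) fun X => by
        simp [hαφ]).symm }
  have hbij : Function.Bijective (φ.coprod αL) := by
    constructor
    · refine (injective_iff_map_eq_zero _).2 ?_
      rintro ⟨X, T⟩ h
      replace h : φ X + α T = 0 := h
      have hX : φ X = 0 := by
        have h0 : ⟪φ X, φ X + α T⟫ = 0 := by rw [h, inner_zero_right]
        rwa [inner_add_right, (hα T) _ (hmem X), add_zero, inner_self_eq_zero] at h0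
      have hT0 : α T = 0 := by rwa [hX, zero_add] at h
      have hT1 : T = 0 := by
        ext Y
        exact hinj (by rw [← hαφ, hT0]; simp)
      rw [hT1, hinj (hX.trans (map_zero φ).symm)]
      rfl
    · intro Z
      obtain ⟨y, hy, z, hz, rfl⟩ := n.exists_add_mem_mem_orthogonal Z
      rw [← hr] at hy
      obtain ⟨X, rfl⟩ := hy
      obtain ⟨T, hTa, h⟩ := hT z hz
      exact ⟨(X, ⟨T, hTa⟩), congrArg (φ X + ·) (huniq ⟨T, hTa⟩ z hz h).symm⟩
  have hΨ : ∀ T, LinearEquiv.ofBijective (φ.coprod αL) hbij (0, T) = α T := fun T => by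
    simp [αL]
  refine ⟨LinearEquiv.ofBijective (φ.coprod αL) hbij, fun X => by simp, fun T => ?_,
    fun T X => ?_⟩
  · rw [hΨ]
    exact hα T
  · rw [hΨ, hαφ]

variable {E' : Type*} [NormedAddCommGroup E'] [InnerProductSpace ℝ E'] [FiniteDimensional ℝ E']
  {μE' : E' →ₗ[ℝ] E' →ₗ[ℝ] E'} {n' : Submodule ℝ E'} {φ' : N →ₗ[ℝ] E'}
  {a' : Submodule ℝ (N →ₗ[ℝ] N)}

/-- An isometric isomorphism of standard constructions restricts to an orthogonal automorphism of
`N` conjugating `a` onto `a'`. -/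
theorem IsStdConstruction.exists_conj_of_isometry (hE : IsStdConstruction N E μN c a μE n φ)
    (hE' : IsStdConstruction N E' μN c a' μE' n' φ') (f : E ≃ₗ[ℝ] E')
    (hf : ∀ X Y, f (μE X Y) = μE' (f X) (f Y)) (hfi : ∀ X Y, ⟪f X, f Y⟫ = ⟪X, Y⟫) :
    ∃ h : N ≃ₗ[ℝ] N, (∀ X Y, h (μN X Y) = μN (h X) (h Y)) ∧
      (∀ X Y, ⟪h X, h Y⟫ = ⟪X, Y⟫) ∧
      Submodule.map (h.conj : (N →ₗ[ℝ] N) ≃ₗ[ℝ] (N →ₗ[ℝ] N)).toLinearMap a = a' := by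
  have hmem := hE.map_mem
  obtain ⟨-, -, hn, hφ, hφμ, -, -, hT, hA, -⟩ := hE
  obtain ⟨-, -, hn', hφ', hφμ', hr', -, hT', hA', -⟩ := hE'
  have hmap : n.map f.toLinearMap = n' := hn.map_eq hf hn'
  have hmap' : n'.map f.symm.toLinearMap = n := hn'.map_eq (symm_map_bracket hf) hn
  have hinj := injective_of_inner_map hφ
  have hinj' := injective_of_inner_map hφ'
  have hex : ∀ X, ∃ Y, φ' Y = f (φ X) := fun X => by
    have : f (φ X) ∈ LinearMap.range φ' := by
      rw [hr', ← hmap]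
      exact ⟨φ X, hmem X, rfl⟩
    exact this
  choose g hg using hex
  let gL : N →ₗ[ℝ] N :=
    { toFun := g
      map_add' := fun X Y => hinj' (by simp [hg])
      map_smul' := fun r X => hinj' (by simp [hg]) }
  have hgi : Function.Injective gL := fun X Y hXY =>
    hinj (f.injective (by rw [← hg, ← hg]; exact congrArg φ' hXY))
  let h : N ≃ₗ[ℝ] N := LinearEquiv.ofInjectiveEndo gL hgi
  have hh : ∀ X, φ' (h X) = f (φ X) := hg
  have hconj : ∀ A T T', (∀ X, μE A (φ X) = φ (T X)) → (∀ X, μE' (f A) (φ' X) = φ' (T' X)) →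
      h.conj T = T' := by
    intro A T T' hAT hAT'
    ext X
    apply hinj'
    rw [LinearEquiv.conj_apply_apply, hh, ← hAT, hf, ← hh, h.apply_symm_apply, hAT']
  refine ⟨h, fun X Y => hinj' ?_, fun X Y => ?_, le_antisymm ?_ fun T' hTa' => ?_⟩
  · rw [hh, hφμ, hf, hφμ', hh, hh]
  · rw [← hφ', hh, hh, hfi, hφ]
  · rintro _ ⟨T, hTa, rfl⟩
    obtain ⟨A, hAn, hAT⟩ := hA T hTa
    obtain ⟨T', hTa', hAT'⟩ := hT' _ (map_mem_orthogonal f hfi hmap hAn)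
    exact (hconj A T T' hAT hAT').symm ▸ hTa'
  · obtain ⟨A', hA'n, hAT'⟩ := hA' T' hTa'
    have hA : f.symm A' ∈ nᗮ := map_mem_orthogonal f.symm (fun X Y => by
      rw [← hfi, f.apply_symm_apply, f.apply_symm_apply]) hmap' hA'n
    obtain ⟨T, hTa, hAT⟩ := hT _ hA
    exact ⟨T, hTa, hconj _ T T' hAT (by simpa using hAT')⟩

/-- An orthogonal automorphism of `N` conjugating `a` onto `a'` extends to an isometric isomorphism
of the standard constructions. -/
theorem IsStdConstruction.exists_isometry_of_conj (hE : IsStdConstruction N E μN c a μE n φ)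
    (hE' : IsStdConstruction N E' μN c a' μE' n' φ') (h : N ≃ₗ[ℝ] N)
    (hμ : ∀ X Y, h (μN X Y) = μN (h X) (h Y)) (hi : ∀ X Y, ⟪h X, h Y⟫ = ⟪X, Y⟫)
    (hconj : Submodule.map (h.conj : (N →ₗ[ℝ] N) ≃ₗ[ℝ] (N →ₗ[ℝ] N)).toLinearMap a = a') :
    ∃ f : E ≃ₗ[ℝ] E',
      (∀ X Y, f (μE X Y) = μE' (f X) (f Y)) ∧ ∀ X Y, ⟪f X, f Y⟫ = ⟪X, Y⟫ := by
  subst hconj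
  obtain ⟨Ψ, hΨφ, hΨn, hΨT⟩ := hE.exists_prodEquiv
  obtain ⟨Ψ', hΨφ', hΨn', hΨT'⟩ := hE'.exists_prodEquiv
  have hmem := hE.map_mem
  have hmem' := hE'.map_mem
  obtain ⟨hLie, -, -, hφ, hφμ, -, hab, -, -, htr⟩ := hE
  obtain ⟨hLie', -, -, hφ', hφμ', -, hab', -, -, htr'⟩ := hE'
  let f : E ≃ₗ[ℝ] E' := Ψ.symm ≪≫ₗ (h.prodCongr (h.conj.submoduleMap a)) ≪≫ₗ Ψ'
  have hfφ : ∀ X, f (φ X) = φ' (h X) := fun X => by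
    rw [← hΨφ, ← hΨφ']
    simp [f]
  have hfn : ∀ T, f (Ψ (0, T)) = Ψ' (0, h.conj.submoduleMap a T) := fun T => by
    simp [f]
  have hdec : ∀ Z, ∃ X T, Z = φ X + Ψ (0, T) := fun Z =>
    ⟨(Ψ.symm Z).1, (Ψ.symm Z).2, by rw [← hΨφ, ← map_add]; simp⟩
  have hmix : ∀ T X, f (μE (Ψ (0, T)) (φ X)) = μE' (f (Ψ (0, T))) (f (φ X)) := fun T X => by
    rw [hΨT, hfφ, hfn, hfφ, hΨT']
    simp [LinearEquiv.conj_apply_apply]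
  have hf : ∀ X Y, f (μE X Y) = μE' (f X) (f Y) := by
    intro Z W
    obtain ⟨X, S, rfl⟩ := hdec Z
    obtain ⟨Y, T, rfl⟩ := hdec W
    have h1 : f (μE (φ X) (φ Y)) = μE' (f (φ X)) (f (φ Y)) := by
      rw [← hφμ, hfφ, hμ, hφμ', hfφ, hfφ]
    have h2 : f (μE (φ X) (Ψ (0, T))) = μE' (f (φ X)) (f (Ψ (0, T))) := by
      rw [hLie.skew, map_neg, hmix, ← hLie'.skew]
    have h3 : f (μE (Ψ (0, S)) (Ψ (0, T))) = μE' (f (Ψ (0, S))) (f (Ψ (0, T))) := by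
      rw [hab _ (hΨn S) _ (hΨn T), hfn, hfn, hab' _ (hΨn' _) _ (hΨn' _), map_zero]
    simp only [map_add, LinearMap.add_apply, h1, h2, h3, hmix]
  refine ⟨f, hf, fun Z W => ?_⟩
  have had : ∀ A, μE' (f A) = f.conj (μE A) := fun A => by
    ext Z
    rw [LinearEquiv.conj_apply_apply, hf, f.apply_symm_apply]
  obtain ⟨X, S, rfl⟩ := hdec Z
  obtain ⟨Y, T, rfl⟩ := hdec W
  have h1 : ⟪f (Ψ (0, S)), f (Ψ (0, T))⟫ = ⟪Ψ (0, S), Ψ (0, T)⟫ := by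
    rw [htr _ (hΨn S) _ (hΨn T), hfn, hfn, htr' _ (hΨn' _) _ (hΨn' _), ← hfn, ← hfn, had, had,
      ← LinearEquiv.conj_comp, LinearMap.trace_conj']
  have h2 : ∀ X T, ⟪f (φ X), f (Ψ (0, T))⟫ = ⟪φ X, Ψ (0, T)⟫ := fun X T => by
    rw [hfφ, hfn, hΨn' _ _ (hmem' _), hΨn _ _ (hmem _)]
  have h3 : ⟪f (φ X), f (φ Y)⟫ = ⟪φ X, φ Y⟫ := by
    rw [hfφ, hfφ, hφ', hi, hφ]
  simp only [map_add, inner_add_left, inner_add_right, h1, h2, h3,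
    real_inner_comm (f (φ Y)) (f (Ψ (0, S))), real_inner_comm (φ Y) (Ψ (0, S))]

end StdConstruction

/-- given a nilsoliton `(N, ⟨⬝,⬝⟩₁)` with `Ric₁ = c I + D₁`, `c < 0`, and two
abelian Lie algebras `a`, `a'` of symmetric derivations of `N`, the solsolitons obtained from
them by the standard construction are isometric (via a Lie algebra isomorphism preserving inner
products) if and only if there is `h ∈ Aut(N) ∩ O(N, ⟨⬝,⬝⟩₁)` with `a' = h a h⁻¹`. -/
theorem construction_isometric_iff_conjugate
    {N : Type*} [NormedAddCommGroup N] [InnerProductSpace ℝ N] [FiniteDimensional ℝ N]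
    (μN : N →ₗ[ℝ] N →ₗ[ℝ] N) (hLieN : IsLieBracket μN) (hnilpN : IsNilpotentOn μN ⊤)
    (c : ℝ) (hc : c < 0) (D₁ : N →ₗ[ℝ] N) (hD₁ : IsDeriv μN D₁)
    (hric : Ric μN = c • LinearMap.id + D₁)
    (a a' : Submodule ℝ (N →ₗ[ℝ] N))
    (ha : ∀ T ∈ a, LinearMap.IsSymmetric T ∧ IsDeriv μN T)
    (haab : ∀ T ∈ a, ∀ T' ∈ a, T ∘ₗ T' = T' ∘ₗ T)
    (ha' : ∀ T ∈ a', LinearMap.IsSymmetric T ∧ IsDeriv μN T)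
    (ha'ab : ∀ T ∈ a', ∀ T' ∈ a', T ∘ₗ T' = T' ∘ₗ T)
    {E : Type*} [NormedAddCommGroup E] [InnerProductSpace ℝ E] [FiniteDimensional ℝ E]
    (μE : E →ₗ[ℝ] E →ₗ[ℝ] E) (n : Submodule ℝ E) (φ : N →ₗ[ℝ] E)
    (hE : IsStdConstruction N E μN c a μE n φ)
    {E' : Type*} [NormedAddCommGroup E'] [InnerProductSpace ℝ E'] [FiniteDimensional ℝ E']
    (μE' : E' →ₗ[ℝ] E' →ₗ[ℝ] E') (n' : Submodule ℝ E') (φ' : N →ₗ[ℝ] E')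
    (hE' : IsStdConstruction N E' μN c a' μE' n' φ') :
    (∃ f : E ≃ₗ[ℝ] E',
        (∀ X Y, f (μE X Y) = μE' (f X) (f Y)) ∧ ∀ X Y, ⟪f X, f Y⟫ = ⟪X, Y⟫) ↔
      ∃ h : N ≃ₗ[ℝ] N, (∀ X Y, h (μN X Y) = μN (h X) (h Y)) ∧
        (∀ X Y, ⟪h X, h Y⟫ = ⟪X, Y⟫) ∧
        Submodule.map (h.conj : (N →ₗ[ℝ] N) ≃ₗ[ℝ] (N →ₗ[ℝ] N)).toLinearMap a = a' := by
  constructor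
  · rintro ⟨f, hf, hfi⟩
    exact hE.exists_conj_of_isometry hE' f hf hfi
  · rintro ⟨h, hμ, hi, hconj⟩
    exact hE.exists_isometry_of_conj hE' h hμ hi hconj
end
end

section
/- Let (s, ⟨·,·⟩) be a metric solvable Lie algebra with nilradical n and a = n^⊥, let β : n → n be any symmetric operator, and define E_β ∈ End(s) by E_β|_a = 0 and E_β|_n = β + ‖β‖²I, where ‖β‖² = tr(β²). Then, for any orthonormal basis {A_r} of a and with μ := [·,·]|_{n×n}, the following identity holds: ⟨π(E_β)[·,·], [·,·]⟩ = Σ_{r,s} ⟨(β + ‖β‖²I)[A_r, A_s], [A_r, A_s]⟩ + 2 Σ_r tr([β, ad A_r|_n] ∘ (ad A_r|_n)ᵗ) + ⟨π(β + ‖β‖²I)μ, μ⟩, where the last inner product is computed over an orthonormal basis of n. -/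
noncomputable section

open scoped RealInnerProductSpace

section Auxiliary

theorem piAct_apply {E : Type*} [AddCommGroup E] [Module ℝ E] (f : E →ₗ[ℝ] E)
    (μ : E →ₗ[ℝ] E →ₗ[ℝ] E) (X Y : E) :
    piAct f μ X Y = f (μ X Y) - μ (f X) Y - μ X (f Y) := rfl

variable {E : Type*} [NormedAddCommGroup E] [InnerProductSpace ℝ E] [FiniteDimensional ℝ E]

theorem trace_comp_transp_eq_sum_inner {ι : Type*} [Fintype ι] (b : OrthonormalBasis ι ℝ E)
    (S T : E →ₗ[ℝ] E) :
    LinearMap.trace ℝ E (S ∘ₗ transp T) = ∑ i, ⟪S (b i), T (b i)⟫ := by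
  rw [LinearMap.trace_comp_comm', LinearMap.trace_eq_sum_inner _ b]
  refine Finset.sum_congr rfl fun i _ => ?_
  rw [LinearMap.comp_apply, transp, LinearMap.adjoint_inner_right, real_inner_comm]

theorem binner_eq_sum {ι : Type*} [Fintype ι] (b : OrthonormalBasis ι ℝ E)
    (μ ν : E →ₗ[ℝ] E →ₗ[ℝ] E) :
    binner μ ν = ∑ i, ∑ j, ⟪μ (b i) (b j), ν (b i) (b j)⟫ := by
  have h (S T : E →ₗ[ℝ] E) :
      ∑ i, ⟪S (stdONB E i), T (stdONB E i)⟫ = ∑ i, ⟪S (b i), T (b i)⟫ := by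
    rw [← trace_comp_transp_eq_sum_inner, ← trace_comp_transp_eq_sum_inner]
  unfold binner
  simp_rw [h]
  rw [Finset.sum_comm]
  conv_rhs => rw [Finset.sum_comm]
  exact Finset.sum_congr rfl fun j _ => h (μ.flip (b j)) (ν.flip (b j))

theorem projL_of_mem {p : Submodule ℝ E} {x : E} (hx : x ∈ p) : projL p x = x :=
  Submodule.starProjection_eq_self_iff.mpr hx

theorem projL_of_mem_orthogonal {p : Submodule ℝ E} {x : E} (hx : x ∈ pᗮ) : projL p x = 0 :=
  (Submodule.starProjection_apply_eq_zero_iff p).mpr hx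

/-- Orthonormal bases of `pᗮ` and `p` together form an orthonormal basis of the whole space. -/
theorem exists_orthonormalBasis_sum_elim {ι κ : Type*} [Fintype ι] [Fintype κ]
    {p : Submodule ℝ E} {v : ι → E} {w : κ → E} (hv : Orthonormal ℝ v) (hw : Orthonormal ℝ w)
    (hvs : Submodule.span ℝ (Set.range v) = pᗮ) (hws : Submodule.span ℝ (Set.range w) = p) :
    ∃ b : OrthonormalBasis (ι ⊕ κ) ℝ E, ⇑b = Sum.elim v w := by
  have hvp (i) : v i ∈ pᗮ := hvs ▸ Submodule.subset_span ⟨i, rfl⟩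
  have hwp (k) : w k ∈ p := hws ▸ Submodule.subset_span ⟨k, rfl⟩
  have hon : Orthonormal ℝ (Sum.elim v w) := by
    refine ⟨?_, ?_⟩
    · rintro (i | k)
      · exact hv.1 i
      · exact hw.1 k
    · rintro (i | k) (j | l) h
      · exact hv.2 fun e => h (congrArg _ e)
      · exact Submodule.inner_left_of_mem_orthogonal (hwp l) (hvp i)
      · exact Submodule.inner_right_of_mem_orthogonal (hwp k) (hvp j)
      · exact hw.2 fun e => h (congrArg _ e)
  refine ⟨OrthonormalBasis.mk hon ?_, OrthonormalBasis.coe_mk _ _⟩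
  rw [Set.Sum.elim_range, Submodule.span_union, hvs, hws, sup_comm,
    Submodule.sup_orthogonal_of_hasOrthogonalProjection]

end Auxiliary

/-- the identity of Lemma `est`.  For a metric solvable Lie algebra with nilradical
`n`, `a = nᗮ`, a symmetric operator `β` of `n` (extended by `0` on `a`) and
`E_β := β + ‖β‖² I` on `n` (i.e. `β + ‖β‖² P_n` on `s`), one has, for any orthonormal basis
`{A_r}` of `a` and any orthonormal basis `{X_i}` of `n` (with `μ̄ := [⬝,⬝]|_{n×n}`):
`⟨π(E_β)[⬝,⬝], [⬝,⬝]⟩ = Σ_{r,s} ⟨E_β [A_r,A_s], [A_r,A_s]⟩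
  + 2 Σ_r tr ([β, ad A_r|_n] ∘ (ad A_r|_n)ᵗ) + ⟨π(β + ‖β‖² I) μ̄, μ̄⟩`. -/
theorem moment_map_three_terms
    {E : Type*} [NormedAddCommGroup E] [InnerProductSpace ℝ E] [FiniteDimensional ℝ E]
    (μ : E →ₗ[ℝ] E →ₗ[ℝ] E) (hLie : IsLieBracket μ) (hsolv : IsSolvableB μ)
    (n : Submodule ℝ E) (hn : IsNilradical μ n)
    (β : E →ₗ[ℝ] E) (hβsym : β.IsSymmetric) (hβn : ∀ X ∈ n, β X ∈ n)
    (hβa : ∀ A ∈ nᗮ, β A = 0)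
    {ιa ιn : Type} [Fintype ιa] [Fintype ιn]
    (BA : ιa → E) (hBAon : Orthonormal ℝ BA) (hBAmem : ∀ r, BA r ∈ nᗮ)
    (hBAspan : Submodule.span ℝ (Set.range BA) = nᗮ)
    (BN : ιn → E) (hBNon : Orthonormal ℝ BN) (hBNmem : ∀ i, BN i ∈ n)
    (hBNspan : Submodule.span ℝ (Set.range BN) = n)
    (Eβ : E →ₗ[ℝ] E) (hEβ : Eβ = β + (LinearMap.trace ℝ E (β ∘ₗ β)) • projL n)
    (μres : E →ₗ[ℝ] E →ₗ[ℝ] E)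
    (hμres : μres = (LinearMap.lcomp ℝ E (projL n)) ∘ₗ μ ∘ₗ projL n) :
    binner (piAct Eβ μ) μ =
      (∑ r, ∑ s, ⟪Eβ (μ (BA r) (BA s)), μ (BA r) (BA s)⟫) +
        2 * (∑ r, LinearMap.trace ℝ E
          ((β ∘ₗ adOn μ n (BA r) - adOn μ n (BA r) ∘ₗ β) ∘ₗ transp (adOn μ n (BA r)))) +
        ∑ i, ∑ j, ⟪(piAct Eβ μres) (BN i) (BN j), μres (BN i) (BN j)⟫ := by
  obtain ⟨b, hb⟩ := exists_orthonormalBasis_sum_elim hBAon hBNon hBAspan hBNspan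
  have hideal := hn.1
  have hskew (X Y) : μ X Y = -μ Y X := by
    have h := hLie.1 (X + Y)
    simp only [map_add, LinearMap.add_apply, hLie.1, zero_add, add_zero] at h
    exact eq_neg_of_add_eq_zero_right h
  set c := LinearMap.trace ℝ E (β ∘ₗ β)
  have hEn {X} (hX : X ∈ n) : Eβ X = β X + c • X := by
    simp [hEβ, projL_of_mem hX]
  have hEmem {X} (hX : X ∈ n) : Eβ X ∈ n := by
    rw [hEn hX]
    exact n.add_mem (hβn X hX) (n.smul_mem c hX)
  have hEa {A} (hA : A ∈ nᗮ) : Eβ A = 0 := by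
    simp [hEβ, hβa A hA, projL_of_mem_orthogonal hA]
  have hres {X Y} (hX : X ∈ n) (hY : Y ∈ n) : μres X Y = μ X Y := by
    simp [hμres, projL_of_mem hX, projL_of_mem hY]
  have hAA (r s) : ⟪piAct Eβ μ (BA r) (BA s), μ (BA r) (BA s)⟫
      = ⟪Eβ (μ (BA r) (BA s)), μ (BA r) (BA s)⟫ := by
    simp [piAct_apply, hEa (hBAmem r), hEa (hBAmem s)]
  have hNA (i r) : ⟪piAct Eβ μ (BN i) (BA r), μ (BN i) (BA r)⟫
      = ⟪piAct Eβ μ (BA r) (BN i), μ (BA r) (BN i)⟫ := by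
    simp only [piAct_apply, hEa (hBAmem r), hskew (BN i) (BA r), hskew (Eβ (BN i)) (BA r),
      map_zero, map_neg, LinearMap.zero_apply, sub_zero, inner_sub_left, inner_neg_left,
      inner_neg_right]
    ring
  have hNN (i j) : ⟪piAct Eβ μ (BN i) (BN j), μ (BN i) (BN j)⟫
      = ⟪piAct Eβ μres (BN i) (BN j), μres (BN i) (BN j)⟫ := by
    simp only [piAct_apply, hres (hBNmem i) (hBNmem j), hres (hEmem (hBNmem i)) (hBNmem j),
      hres (hBNmem i) (hEmem (hBNmem j))]
  have htrace (r) : LinearMap.trace ℝ E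
      ((β ∘ₗ adOn μ n (BA r) - adOn μ n (BA r) ∘ₗ β) ∘ₗ transp (adOn μ n (BA r)))
      = ∑ i, ⟪piAct Eβ μ (BA r) (BN i), μ (BA r) (BN i)⟫ := by
    rw [trace_comp_transp_eq_sum_inner b, hb, Fintype.sum_sum_type]
    have hzero (s) : adOn μ n (BA r) (BA s) = 0 := by
      simp [adOn, projL_of_mem_orthogonal (hBAmem s)]
    simp only [Sum.elim_inl, Sum.elim_inr, hzero, inner_zero_right, Finset.sum_const_zero,
      zero_add]
    refine Finset.sum_congr rfl fun i _ => ?_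
    have hX := hBNmem i
    simp [adOn, piAct_apply, projL_of_mem hX, projL_of_mem (hβn _ hX), hEa (hBAmem r),
      hEn (hideal (BA r) _ hX), hEn hX]
  rw [binner_eq_sum b, hb]
  simp only [Fintype.sum_sum_type, Sum.elim_inl, Sum.elim_inr, Finset.sum_add_distrib, hAA, hNA,
    hNN, htrace]
  rw [Finset.sum_comm (s := (Finset.univ : Finset ιn)) (t := (Finset.univ : Finset ιa))]
  ring
end
end

section
/- Let (s, ⟨·,·⟩) be a metric solvable Lie algebra. Then tr(R·D) = 0 and tr(B·D) = 0 for every derivation D of s. -/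
noncomputable section

open scoped RealInnerProductSpace

section DerivationTrace

variable {E : Type*} [AddCommGroup E] [Module ℝ E]

lemma IsDeriv.comp_eq {μ : E →ₗ[ℝ] E →ₗ[ℝ] E} {D : E →ₗ[ℝ] E}
    (hD : IsDeriv μ D) (X : E) : D ∘ₗ μ X = μ (D X) + μ X ∘ₗ D := by
  ext Y
  simp [hD X Y]

lemma IsLieBracket.swap {μ : E →ₗ[ℝ] E →ₗ[ℝ] E}
    (hμ : IsLieBracket μ) (X Y : E) : μ X Y = -μ Y X := by
  have h := hμ.1 (X + Y)
  simp only [map_add, LinearMap.add_apply, hμ.1, zero_add, add_zero] at h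
  exact eq_neg_of_add_eq_zero_right h

/-- A derivation is skew with respect to the Killing form `κ`: `κ(D X, X) = 0`. -/
lemma IsDeriv.trace_comp_self_eq_zero {μ : E →ₗ[ℝ] E →ₗ[ℝ] E}
    {D : E →ₗ[ℝ] E} (hD : IsDeriv μ D) (X : E) :
    LinearMap.trace ℝ E (μ (D X) ∘ₗ μ X) = 0 := by
  have h : μ (D X) = D ∘ₗ μ X - μ X ∘ₗ D := by rw [hD.comp_eq]; abel
  rw [h, LinearMap.sub_comp, map_sub, sub_eq_zero]
  exact LinearMap.trace_mul_comm ℝ (D ∘ₗ μ X) (μ X)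

lemma sum_linearMap_comp {ι : Type*} (s : Finset ι) (f : ι → E →ₗ[ℝ] E) (g : E →ₗ[ℝ] E) :
    (∑ i ∈ s, f i) ∘ₗ g = ∑ i ∈ s, f i ∘ₗ g :=
  Finset.sum_mul s f g

end DerivationTrace

section MetricTrace

variable {E : Type*} [NormedAddCommGroup E] [InnerProductSpace ℝ E] [FiniteDimensional ℝ E]

lemma trace_transp_comp (f g : E →ₗ[ℝ] E) :
    LinearMap.trace ℝ E (transp f ∘ₗ g) = ∑ j, ⟪f (stdONB E j), g (stdONB E j)⟫ := by
  rw [LinearMap.trace_eq_sum_inner _ (stdONB E)]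
  simp [transp, LinearMap.adjoint_inner_right]

lemma trace_Bop_comp (μ : E →ₗ[ℝ] E →ₗ[ℝ] E) (D : E →ₗ[ℝ] E) :
    LinearMap.trace ℝ E (Bop μ ∘ₗ D) =
      ∑ i, LinearMap.trace ℝ E (μ (D (stdONB E i)) ∘ₗ μ (stdONB E i)) := by
  simp only [Bop, sum_linearMap_comp, map_sum]
  exact Finset.sum_congr rfl fun i _ => LinearMap.trace_smulRight
    ((LinearMap.trace ℝ E ∘ₗ LinearMap.lcomp ℝ E (μ (stdONB E i)) ∘ₗ μ) ∘ₗ D) (stdONB E i)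

lemma sum_trace_transp_ad_comp_ad_comp {μ : E →ₗ[ℝ] E →ₗ[ℝ] E} (hμ : IsLieBracket μ)
    (D : E →ₗ[ℝ] E) :
    ∑ i, LinearMap.trace ℝ E (transp (μ (stdONB E i)) ∘ₗ (μ (stdONB E i) ∘ₗ D)) =
      ∑ i, LinearMap.trace ℝ E (transp (μ (stdONB E i)) ∘ₗ μ (D (stdONB E i))) := by
  simp only [trace_transp_comp, LinearMap.comp_apply]
  rw [Finset.sum_comm]
  refine Finset.sum_congr rfl fun j _ => Finset.sum_congr rfl fun i _ => ?_
  rw [hμ.swap (stdONB E i), hμ.swap (stdONB E i), inner_neg_neg]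

lemma trace_Rop_comp (μ : E →ₗ[ℝ] E →ₗ[ℝ] E) (D : E →ₗ[ℝ] E) :
    LinearMap.trace ℝ E (Rop μ ∘ₗ D) =
      -(1 / 2 : ℝ) *
          ∑ i, LinearMap.trace ℝ E (transp (μ (stdONB E i)) ∘ₗ (μ (stdONB E i) ∘ₗ D)) +
        (1 / 4 : ℝ) *
          ∑ i, LinearMap.trace ℝ E (transp (μ (stdONB E i)) ∘ₗ (D ∘ₗ μ (stdONB E i))) := by
  have h (A : E →ₗ[ℝ] E) : LinearMap.trace ℝ E ((A ∘ₗ transp A) ∘ₗ D) =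
      LinearMap.trace ℝ E (transp A ∘ₗ (D ∘ₗ A)) := by
    rw [LinearMap.comp_assoc, LinearMap.trace_comp_comm', LinearMap.comp_assoc]
  simp only [Rop, LinearMap.add_comp, LinearMap.smul_comp, sum_linearMap_comp, map_add, map_smul,
    map_sum, h, smul_eq_mul]
  simp only [LinearMap.comp_assoc]

end MetricTrace

/-- for a metric solvable Lie algebra, `tr (R ∘ D) = 0` and `tr (B ∘ D) = 0` for
every derivation `D`. -/
theorem trace_R_B_deriv_zero
    {E : Type*} [NormedAddCommGroup E] [InnerProductSpace ℝ E] [FiniteDimensional ℝ E]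
    (μ : E →ₗ[ℝ] E →ₗ[ℝ] E) (hLie : IsLieBracket μ) (hsolv : IsSolvableB μ)
    (D : E →ₗ[ℝ] E) (hD : IsDeriv μ D) :
    LinearMap.trace ℝ E (Rop μ ∘ₗ D) = 0 ∧ LinearMap.trace ℝ E (Bop μ ∘ₗ D) = 0 := by
  refine ⟨?_, ?_⟩
  · rw [trace_Rop_comp]
    simp only [hD.comp_eq, LinearMap.comp_add, map_add, Finset.sum_add_distrib,
      sum_trace_transp_ad_comp_ad_comp hLie]
    ring
  · rw [trace_Bop_comp]
    exact Finset.sum_eq_zero fun i _ => hD.trace_comp_self_eq_zero _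
end
end

section
/- Let s = ℝA ⊕ n be a finite-dimensional real solvable Lie algebra whose nilradical n is abelian and has codimension one. If the operator ad A|_n : n → n is not semisimple (i.e. not diagonalizable over ℂ), then s admits no solsoliton: there is no inner product ⟨·,·⟩ on s whose Ricci operator satisfies Ric = cI + D for some c ∈ ℝ and derivation D of s. -/
noncomputable section

open scoped RealInnerProductSpace

section OperatorLemmas

theorem isNilpotent_of_mul_eq_mul_add_smul {E : Type*} [AddCommGroup E] [Module ℝ E]
    [FiniteDimensional ℝ E] {D T : Module.End ℝ E} {c : ℝ} (hc : c ≠ 0)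
    (h : D * T = T * D + c • T) : IsNilpotent T := by
  by_contra hT
  have hT0 : ∀ k, T ^ k ≠ 0 := fun k hk => hT ⟨k, hk⟩
  have hpow : ∀ k : ℕ, D * T ^ k = T ^ k * D + (k * c) • T ^ k := by
    intro k
    induction k with
    | zero => simp
    | succ k ih =>
      rw [pow_succ, ← mul_assoc, ih, add_mul, mul_assoc, h, mul_add, smul_mul_assoc,
        mul_smul_comm, mul_assoc, add_assoc, ← add_smul]
      push_cast
      congr 2
      ring
  let F : Module.End ℝ (Module.End ℝ E) := LinearMap.mulLeft ℝ D - LinearMap.mulRight ℝ D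
  have hev : ∀ k : ℕ, F.HasEigenvalue (k * c) := fun k =>
    Module.End.hasEigenvalue_of_hasEigenvector (x := T ^ k)
      ⟨by simp [F, hpow k], hT0 k⟩
  refine Set.infinite_of_injective_forall_mem (f := fun k : ℕ => (k : ℝ) * c) ?_ hev
    F.finite_hasEigenvalue
  intro i j hij
  exact_mod_cast mul_right_cancel₀ hc hij

variable {E : Type*} [NormedAddCommGroup E] [InnerProductSpace ℝ E] [FiniteDimensional ℝ E]

theorem eq_zero_of_star_mul_self_eq_zero {S : Module.End ℝ E} (h : star S * S = 0) : S = 0 := by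
  have h1 := S.ker_adjoint_comp_self
  rw [show LinearMap.adjoint S ∘ₗ S = 0 from h, LinearMap.ker_zero] at h1
  exact LinearMap.ker_eq_top.mp h1.symm

theorem eq_zero_of_trace_star_mul_self_eq_zero {S : Module.End ℝ E}
    (h : LinearMap.trace ℝ E (star S * S) = 0) : S = 0 := by
  rw [LinearMap.trace_eq_sum_inner _ (stdONB E), Finset.sum_eq_zero_iff_of_nonneg] at h
  · refine (stdONB E).toBasis.ext fun i => ?_
    simpa [LinearMap.star_eq_adjoint, LinearMap.adjoint_inner_right] using h i (Finset.mem_univ i)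
  · intro i _
    simp [LinearMap.star_eq_adjoint, LinearMap.adjoint_inner_right]

/-- A normal operator on a finite-dimensional real inner product space is semisimple. -/
theorem isSemisimple_of_commute_star {T : Module.End ℝ E} (hT : Commute (star T) T) :
    T.IsSemisimple := by
  obtain ⟨N, hN, S, -, hNnil, hS, hTS⟩ := T.exists_isNilpotent_isSemisimple
  have h1 : Commute (star T) N := Algebra.commute_of_mem_adjoin_singleton_of_commute hN hT
  have h2 : Commute (star N) T := by simpa using h1.star_star.symm
  have h3 : Commute (star N) N := Algebra.commute_of_mem_adjoin_singleton_of_commute hN h2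
  have h4 : IsNilpotent (star N * N) := h3.isNilpotent_mul_left hNnil
  have h5 : (star N * N).IsFinitelySemisimple :=
    LinearMap.IsSymmetric.isFinitelySemisimple (LinearMap.isSymmetric_adjoint_comp_self N)
  have h6 := eq_zero_of_star_mul_self_eq_zero
    (Module.End.eq_zero_of_isNilpotent_of_isFinitelySemisimple h4 h5)
  rw [hTS, h6, zero_add]
  exact hS

end OperatorLemmas

section AlmostAbelian

theorem isNilpotentOn_top {E : Type*} [NormedAddCommGroup E] [InnerProductSpace ℝ E]
    {μ : E →ₗ[ℝ] E →ₗ[ℝ] E} {T : Module.End ℝ E} {a : E}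
    (hμ : ∀ X Y, μ X Y = ⟪a, X⟫ • T Y - ⟪a, Y⟫ • T X)
    (haT : ∀ X, ⟪a, T X⟫ = 0) (hT : IsNilpotent T) : IsNilpotentOn μ ⊤ := by
  obtain ⟨k, hk⟩ := hT
  have key : ∀ j : ℕ, lcsOn μ ⊤ (j + 1) ≤ LinearMap.range (T ^ (j + 1)) := by
    intro j
    induction j with
    | zero =>
      refine Submodule.span_le.mpr ?_
      rintro _ ⟨X, -, Y, -, rfl⟩
      exact ⟨⟪a, X⟫ • Y - ⟪a, Y⟫ • X, by simp [hμ]⟩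
    | succ j ih =>
      refine Submodule.span_le.mpr ?_
      rintro _ ⟨X, -, Y, hY, rfl⟩
      obtain ⟨Z, rfl⟩ := ih hY
      have h0 : ⟪a, (T ^ (j + 1)) Z⟫ = 0 := by
        rw [pow_succ', Module.End.mul_apply, haT]
      refine ⟨⟪a, X⟫ • Z, ?_⟩
      rw [hμ, h0, pow_succ' T (j + 1)]
      simp
  refine ⟨k + 1, le_bot_iff.mp ((key k).trans ?_)⟩
  rw [pow_succ, hk, zero_mul, LinearMap.range_zero]

variable {E : Type*} [NormedAddCommGroup E] [InnerProductSpace ℝ E] [FiniteDimensional ℝ E]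

theorem exists_unit_normal {n : Submodule ℝ E}
    (hcodim : Module.finrank ℝ n + 1 = Module.finrank ℝ E) :
    ∃ a : E, ⟪a, a⟫ = 1 ∧ (∀ Y ∈ n, ⟪a, Y⟫ = 0) ∧ ∀ X, X - ⟪a, X⟫ • a ∈ n := by
  have h1 : Module.finrank ℝ nᗮ = 1 := by
    have := n.finrank_add_finrank_orthogonal
    omega
  have : Nontrivial nᗮ := Module.nontrivial_of_finrank_pos (R := ℝ) (by omega)
  obtain ⟨v, hv⟩ := exists_norm_eq nᗮ zero_le_one
  have hv0 : v ≠ 0 := by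
    rintro rfl
    simp at hv
  have hvv : ⟪(v : E), (v : E)⟫ = 1 := by
    rw [real_inner_self_eq_norm_sq, Submodule.norm_coe, hv, one_pow]
  have hvn : ∀ Y ∈ n, ⟪(v : E), Y⟫ = 0 := fun Y hY => Submodule.inner_left_of_mem_orthogonal hY v.2
  refine ⟨v, hvv, hvn, fun X => ?_⟩
  refine n.orthogonal_orthogonal.le ((Submodule.mem_orthogonal _ _).mpr ?_)
  intro w hw
  obtain ⟨c, hc⟩ := (finrank_eq_one_iff_of_nonzero' v hv0).mp h1 ⟨w, hw⟩
  have hc' : w = c • (v : E) := by simpa using congrArg Subtype.val hc.symm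
  rw [hc', inner_sub_right, real_inner_smul_left, real_inner_smul_right, real_inner_smul_left, hvv]
  ring

variable {μ : E →ₗ[ℝ] E →ₗ[ℝ] E} {T : Module.End ℝ E} {a : E}

theorem Rop_eq (hμ : ∀ X Y, μ X Y = ⟪a, X⟫ • T Y - ⟪a, Y⟫ • T X) (ha : ⟪a, a⟫ = 1)
    (hTa : T a = 0) :
    ∃ β : ℝ, Rop μ = (1 / 2 : ℝ) • (T * star T - star T * T)
      - β • (innerₛₗ ℝ a).smulRight a := by
  set e := stdONB E
  have htr : ∀ X Z, transp (μ X) Z = ⟪a, X⟫ • star T Z - ⟪T X, Z⟫ • a := by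
    intro X Z
    refine ext_inner_right ℝ fun Y => ?_
    simp only [transp, LinearMap.adjoint_inner_left, hμ, inner_sub_left, inner_sub_right,
      real_inner_smul_left, real_inner_smul_right, LinearMap.star_eq_adjoint]
    rw [real_inner_comm (T X) Z]
    ring
  have hstar : ∀ X, ⟪a, star T X⟫ = 0 := fun X => by
    rw [LinearMap.star_eq_adjoint, LinearMap.adjoint_inner_right, hTa, inner_zero_left]
  have hea : ∑ i, ⟪a, e i⟫ * ⟪a, e i⟫ = 1 := by
    simp_rw [← ha, ← e.sum_inner_mul_inner a a, real_inner_comm a]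
  have hTe : ∑ i, ⟪a, e i⟫ • T (e i) = 0 := by
    have := congrArg T (e.sum_repr' a)
    simpa [real_inner_comm, hTa] using this
  have h1 : ∀ X, ∑ i, transp (μ (e i)) (μ (e i) X)
      = star T (T X) + (∑ i, ⟪T (e i), T (e i)⟫) • ⟪a, X⟫ • a := by
    intro X
    have : ∀ i, transp (μ (e i)) (μ (e i) X) = (⟪a, e i⟫ * ⟪a, e i⟫) • star T (T X)
        - ⟪a, X⟫ • star T (⟪a, e i⟫ • T (e i)) - ⟪⟪a, e i⟫ • T (e i), T X⟫ • a
        + ⟪T (e i), T (e i)⟫ • ⟪a, X⟫ • a := by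
      intro i
      rw [htr, hμ]
      simp only [map_sub, map_smul, inner_sub_right, real_inner_smul_right, real_inner_smul_left]
      module
    simp only [this, Finset.sum_add_distrib, Finset.sum_sub_distrib, ← Finset.sum_smul, hea,
      ← Finset.smul_sum, ← map_sum, ← sum_inner, hTe]
    simp
  have h2 : ∀ X, ∑ i, μ (e i) (transp (μ (e i)) X) = (2 : ℝ) • T (star T X) := by
    intro X
    have : ∀ i, μ (e i) (transp (μ (e i)) X) = (⟪a, e i⟫ * ⟪a, e i⟫) • T (star T X)
        + T (⟪e i, star T X⟫ • e i) := by
      intro i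
      rw [hμ, htr]
      simp only [map_sub, map_smul, inner_sub_right, real_inner_smul_right, hstar, hTa, ha]
      rw [LinearMap.star_eq_adjoint, LinearMap.adjoint_inner_right]
      module
    simp only [this, Finset.sum_add_distrib, ← Finset.sum_smul, hea, ← map_sum, e.sum_repr']
    module
  refine ⟨(1 / 2) * ∑ i, ⟪T (e i), T (e i)⟫, LinearMap.ext fun X => ?_⟩
  simp only [Rop, LinearMap.add_apply, LinearMap.smul_apply, LinearMap.sum_apply,
    LinearMap.comp_apply]
  rw [h1, h2]
  simp only [LinearMap.sub_apply, LinearMap.smul_apply, LinearMap.smulRight_apply,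
    innerₛₗ_apply_apply, Module.End.mul_apply]
  module

theorem Bop_eq (hμ : ∀ X Y, μ X Y = ⟪a, X⟫ • T Y - ⟪a, Y⟫ • T X)
    (haT : ∀ X, ⟪a, T X⟫ = 0) :
    Bop μ = LinearMap.trace ℝ E (T * T) • (innerₛₗ ℝ a).smulRight a := by
  have h : ∀ X Y, LinearMap.trace ℝ E (μ X ∘ₗ μ Y)
      = ⟪a, X⟫ * ⟪a, Y⟫ * LinearMap.trace ℝ E (T * T) := by
    intro X Y
    have : μ X ∘ₗ μ Y = (⟪a, X⟫ * ⟪a, Y⟫) • (T * T)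
        - ⟪a, X⟫ • (innerₛₗ ℝ a).smulRight (T (T Y)) := by
      ext Z
      simp only [LinearMap.comp_apply, hμ, LinearMap.sub_apply, LinearMap.smul_apply,
        LinearMap.smulRight_apply, innerₛₗ_apply_apply, Module.End.mul_apply, map_sub, map_smul,
        inner_sub_right, real_inner_smul_right, haT]
      module
    rw [this, map_sub, map_smul, map_smul, LinearMap.trace_smulRight, innerₛₗ_apply_apply, haT]
    simp
  ext X
  simp only [Bop, LinearMap.sum_apply, LinearMap.smulRight_apply, LinearMap.comp_apply,
    LinearMap.lcomp_apply', h, LinearMap.smul_apply, innerₛₗ_apply_apply]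
  conv_rhs => rw [← (stdONB E).sum_repr' a]
  simp only [Finset.smul_sum, smul_smul]
  refine Finset.sum_congr rfl fun i _ => ?_
  rw [(stdONB E).sum_repr', real_inner_comm a]
  ring_nf

theorem meanCurv_eq (hμ : ∀ X Y, μ X Y = ⟪a, X⟫ • T Y - ⟪a, Y⟫ • T X)
    (haT : ∀ X, ⟪a, T X⟫ = 0) :
    meanCurv μ = LinearMap.trace ℝ E T • a := by
  have h : ∀ X, LinearMap.trace ℝ E (μ X) = LinearMap.trace ℝ E T * ⟪X, a⟫ := by
    intro X
    have : μ X = ⟪a, X⟫ • T - (innerₛₗ ℝ a).smulRight (T X) := by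
      ext Z
      simp [hμ]
    rw [this, map_sub, map_smul, LinearMap.trace_smulRight, innerₛₗ_apply_apply, haT,
      real_inner_comm]
    simp [mul_comm]
  simp only [meanCurv, h, mul_smul, ← Finset.smul_sum, (stdONB E).sum_repr']

theorem Ric_eq (hμ : ∀ X Y, μ X Y = ⟪a, X⟫ • T Y - ⟪a, Y⟫ • T X) (ha : ⟪a, a⟫ = 1)
    (hTa : T a = 0) (haT : ∀ X, ⟪a, T X⟫ = 0) :
    ∃ β : ℝ, Ric μ = (1 / 2 : ℝ) • (T * star T - star T * T)
      - (LinearMap.trace ℝ E T / 2) • (T + star T) - β • (innerₛₗ ℝ a).smulRight a := by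
  obtain ⟨β, hβ⟩ := Rop_eq hμ ha hTa
  have hμa : μ a = T := by
    ext Y
    rw [hμ, ha, hTa, one_smul, smul_zero, sub_zero]
  refine ⟨β + 1 / 2 * LinearMap.trace ℝ E (T * T), ?_⟩
  have hS : symPart (μ (meanCurv μ)) = (LinearMap.trace ℝ E T / 2) • (T + star T) := by
    rw [meanCurv_eq hμ haT, map_smul, hμa, symPart, transp, LinearMap.star_eq_adjoint, map_smulₛₗ]
    simp only [conj_trivial]
    module
  rw [Ric, hβ, Bop_eq hμ haT, hS]
  module

/-- If `Ric = c I + D` with `D` a derivation, then `ad a` is nilpotent or normal. -/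
theorem isNilpotent_or_commute_star (hμ : ∀ X Y, μ X Y = ⟪a, X⟫ • T Y - ⟪a, Y⟫ • T X)
    (ha : ⟪a, a⟫ = 1) (hTa : T a = 0) (haT : ∀ X, ⟪a, T X⟫ = 0) (hsol : IsSolsoliton μ) :
    IsNilpotent T ∨ Commute (star T) T := by
  obtain ⟨c, D, hD, hRic⟩ := hsol
  obtain ⟨β, hβ⟩ := Ric_eq hμ ha hTa haT
  set t := LinearMap.trace ℝ E T
  set P : Module.End ℝ E := (innerₛₗ ℝ a).smulRight a with hP
  have hDeq : D = (1 / 2 : ℝ) • (T * star T - star T * T) - (t / 2) • (T + star T)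
      - β • P - c • (1 : Module.End ℝ E) := by
    rw [← hβ, hRic]
    exact (add_sub_cancel_left _ _).symm
  have hsTa : star T a = 0 := by
    refine ext_inner_right ℝ fun Y => ?_
    rw [LinearMap.star_eq_adjoint, LinearMap.adjoint_inner_left, haT, inner_zero_left]
  have hDa : D a = (-β - c) • a := by
    rw [hDeq]
    simp only [LinearMap.sub_apply, LinearMap.smul_apply, LinearMap.add_apply,
      Module.End.mul_apply, hTa, hsTa, map_zero, hP, LinearMap.smulRight_apply,
      innerₛₗ_apply_apply, ha, Module.End.one_apply]
    module
  have hμa : μ a = T := by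
    ext Y
    rw [hμ, ha, hTa, one_smul, smul_zero, sub_zero]
  have hDT : D * T = T * D + (-β - c) • T := by
    ext Y
    have := hD a Y
    rw [hDa, map_smul, hμa] at this
    rw [Module.End.mul_apply, this]
    simp [add_comm]
  by_cases hl : -β - c = 0
  · right
    rw [hl, zero_smul, add_zero] at hDT
    set C : Module.End ℝ E := T * star T - star T * T with hC
    have hCP : C * P = 0 := by
      ext X
      simp [hC, hP, hTa, hsTa]
    have hCs : star C = C := by simp [hC]
    have hCD : LinearMap.trace ℝ E (C * D) = 0 := by
      rw [hC, sub_mul, map_sub, mul_assoc, LinearMap.trace_mul_comm ℝ T, mul_assoc, mul_assoc,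
        hDT, sub_self]
    have hCT : LinearMap.trace ℝ E (C * T) = 0 := by
      rw [hC, sub_mul, map_sub, mul_assoc, LinearMap.trace_mul_comm ℝ T, sub_self]
    have hCsT : LinearMap.trace ℝ E (C * star T) = 0 := by
      rw [hC, sub_mul, map_sub, LinearMap.trace_mul_comm ℝ (T * star T), mul_assoc, sub_self]
    have hC1 : LinearMap.trace ℝ E C = 0 := by
      rw [hC, map_sub, LinearMap.trace_mul_comm ℝ T, sub_self]
    have hCC : LinearMap.trace ℝ E (star C * C) = 0 := by
      rw [hDeq] at hCD
      simp only [mul_sub, mul_smul_comm, mul_add, map_sub, map_smul, map_add, mul_one, hCT, hCsT,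
        hCP, hC1, map_zero, smul_eq_mul] at hCD
      rw [hCs]
      linarith
    exact (sub_eq_zero.mp (eq_zero_of_trace_star_mul_self_eq_zero hCC)).symm
  · exact Or.inl (isNilpotent_of_mul_eq_mul_add_smul hl hDT)

end AlmostAbelian

/-- a solvable Lie algebra `s = ℝA ⊕ n` with abelian nilradical `n` of codimension
one such that `ad A|ₙ` is not semisimple admits no solsoliton: no inner product on it has Ricci
operator of the form `c I + D` with `D` a derivation.  (The metric structure is universally
quantified, so this states that no inner product on such a Lie algebra is a solsoliton.) -/
theorem no_solsoliton_of_not_semisimple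
    {E : Type*} [NormedAddCommGroup E] [InnerProductSpace ℝ E] [FiniteDimensional ℝ E]
    (μ : E →ₗ[ℝ] E →ₗ[ℝ] E) (hLie : IsLieBracket μ) (hsolv : IsSolvableB μ)
    (n : Submodule ℝ E) (hn : IsNilradical μ n)
    (habel : ∀ X ∈ n, ∀ Y ∈ n, μ X Y = 0)
    (A : E) (hA : A ∉ n)
    (hcodim : Module.finrank ℝ ↥n + 1 = Module.finrank ℝ E)
    (hmaps : ∀ X ∈ n, μ A X ∈ n)
    (hss : ¬ Module.End.IsSemisimple ((μ A).restrict hmaps)) :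
    ¬ IsSolsoliton μ := by
  intro hsol
  obtain ⟨a, ha, han, hproj⟩ := exists_unit_normal hcodim
  have hanti : ∀ X Y, μ X Y = -μ Y X := by
    intro X Y
    have := hLie.1 (X + Y)
    simp only [map_add, LinearMap.add_apply, hLie.1, zero_add, add_zero] at this
    exact eq_neg_of_add_eq_zero_right this
  have hμ : ∀ X Y, μ X Y = ⟪a, X⟫ • μ a Y - ⟪a, Y⟫ • μ a X := by
    intro X Y
    have h := habel _ (hproj X) _ (hproj Y)
    simp only [map_sub, map_smul, LinearMap.sub_apply, LinearMap.smul_apply, hLie.1, smul_zero,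
      sub_zero, hanti X a, smul_neg, sub_neg_eq_add] at h
    rw [← sub_eq_zero, ← h]
    abel
  have haT : ∀ X, ⟪a, μ a X⟫ = 0 := by
    intro X
    have h := han _ (hn.1 a _ (hproj X))
    simpa [hLie.1] using h
  rcases isNilpotent_or_commute_star hμ ha (hLie.1 a) haT hsol with hnil | hcomm
  · exact hA (hn.2.2 ⊤ (fun _ _ _ => Submodule.mem_top) (isNilpotentOn_top hμ haT hnil)
      Submodule.mem_top)
  · have hinv : n ∈ Module.End.invtSubmodule (μ a) := fun Y hY => hn.1 a Y hY
    have h := Module.End.IsSemisimple_smul ⟪a, A⟫ ((isSemisimple_of_commute_star hcomm).restrict hinv)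
    have heq : (μ A).restrict hmaps = ⟪a, A⟫ • (μ a).restrict hinv := by
      ext Y
      simp [hμ A Y, han Y Y.2]
      rfl
    exact hss (heq ▸ h)
end
end

section
/- Let s be a 3-dimensional real solvable Lie algebra that is not nilpotent. Then s admits a solsoliton inner product if and only if s is not isomorphic to the Lie algebra r₃, where r₃ has a basis {A, X₁, X₂} with nonzero brackets [A, X₁] = X₁ and [A, X₂] = X₁ + X₂ (and [X₁, X₂] = 0). -/
noncomputable section

open scoped RealInnerProductSpace

section ThreeDim

/-- The Lie bracket of the `3`-dimensional solvable Lie algebra `r₃` on the basis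
`{A, X₁, X₂} = {e₀, e₁, e₂}`: `[A, X₁] = X₁`, `[A, X₂] = X₁ + X₂`. -/
def r3Bracket : (Fin 3 → ℝ) →ₗ[ℝ] (Fin 3 → ℝ) →ₗ[ℝ] (Fin 3 → ℝ) :=
  LinearMap.mk₂ ℝ
    (fun X Y => ![0, (X 0 * Y 1 - Y 0 * X 1) + (X 0 * Y 2 - Y 0 * X 2),
      X 0 * Y 2 - Y 0 * X 2])
    (by intro X X' Y; funext i; fin_cases i <;> simp <;> ring)
    (by intro c X Y; funext i; fin_cases i <;> simp <;> ring)
    (by intro X Y Y'; funext i; fin_cases i <;> simp <;> ring)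
    (by intro c X Y; funext i; fin_cases i <;> simp <;> ring)

end ThreeDim

section RicciFormula

variable {E : Type*} [NormedAddCommGroup E] [InnerProductSpace ℝ E]

/-- The metric trace of a bilinear form does not depend on the orthonormal basis. -/
theorem OrthonormalBasis.sum_bilin_self_eq {ι κ : Type*} [Fintype ι] [Fintype κ]
    (b : OrthonormalBasis ι ℝ E) (b' : OrthonormalBasis κ ℝ E) (β : E →ₗ[ℝ] E →ₗ[ℝ] ℝ) :
    ∑ i, β (b i) (b i) = ∑ j, β (b' j) (b' j) := by
  classical
  have expand : ∀ i, β (b i) (b i)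
      = ∑ j, ∑ k, (⟪b' j, b i⟫ * ⟪b i, b' k⟫) * β (b' j) (b' k) := by
    intro i
    conv_lhs => rw [← b'.sum_repr' (b i)]
    simp only [map_sum, map_smul, LinearMap.sum_apply, LinearMap.smul_apply, smul_eq_mul,
      Finset.mul_sum]
    rw [Finset.sum_comm]
    refine Finset.sum_congr rfl fun j _ => Finset.sum_congr rfl fun k _ => ?_
    rw [real_inner_comm (b' k) (b i)]
    ring
  simp only [expand]
  rw [Finset.sum_comm]
  refine Finset.sum_congr rfl fun j _ => ?_
  rw [Finset.sum_comm]
  simp only [← Finset.sum_mul, b.sum_inner_mul_inner]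
  simp [b'.inner_eq_ite]

variable [FiniteDimensional ℝ E]

theorem inner_meanCurv (μ : E →ₗ[ℝ] E →ₗ[ℝ] E) (x : E) :
    ⟪meanCurv μ, x⟫ = LinearMap.trace ℝ E (μ x) := by
  conv_rhs => rw [← (stdONB E).sum_repr' x]
  simp [meanCurv, sum_inner, inner_smul_left, mul_comm]

theorem inner_Bop (μ : E →ₗ[ℝ] E →ₗ[ℝ] E) (x y : E) :
    ⟪Bop μ x, y⟫ = LinearMap.trace ℝ E (μ x ∘ₗ μ y) := by
  have h : ∀ z, LinearMap.trace ℝ E (μ x ∘ₗ μ z)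
      = ((LinearMap.trace ℝ E) ∘ₗ (LinearMap.llcomp ℝ E E E (μ x)) ∘ₗ μ) z := fun _ => rfl
  rw [h]
  conv_rhs => rw [← (stdONB E).sum_repr' y, map_sum]
  simp only [Bop, LinearMap.sum_apply, LinearMap.smulRight_apply, sum_inner, inner_smul_left]
  refine Finset.sum_congr rfl fun i _ => ?_
  rw [map_smul, ← h]
  rw [smul_eq_mul, mul_comm]
  rfl

theorem inner_Rop {ι : Type*} [Fintype ι] (b : OrthonormalBasis ι ℝ E)
    (μ : E →ₗ[ℝ] E →ₗ[ℝ] E) (x y : E) :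
    ⟪Rop μ x, y⟫ = -(1 / 2) * ∑ i, ⟪μ (b i) x, μ (b i) y⟫
      + (1 / 4) * ∑ i, ∑ j, ⟪μ (b i) (b j), x⟫ * ⟪μ (b i) (b j), y⟫ := by
  have h₁ := (stdONB E).sum_bilin_self_eq b
    ((innerₗ E).compl₁₂ (μ.flip x) (μ.flip y))
  have h₂ : ∑ i, ∑ j, ⟪μ (stdONB E i) (b j), x⟫ * ⟪μ (stdONB E i) (b j), y⟫
      = ∑ i, ∑ j, ⟪μ (b i) (b j), x⟫ * ⟪μ (b i) (b j), y⟫ := by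
    rw [Finset.sum_comm]
    conv_rhs => rw [Finset.sum_comm]
    refine Finset.sum_congr rfl fun j _ => ?_
    have := (stdONB E).sum_bilin_self_eq b
      ((LinearMap.mul ℝ ℝ).compl₁₂ ((innerₗ E x) ∘ₗ (μ.flip (b j))) ((innerₗ E y) ∘ₗ (μ.flip (b j))))
    simpa [real_inner_comm] using this
  have h₃ : ∀ i, ⟪μ (stdONB E i) (transp (μ (stdONB E i)) x), y⟫
      = ∑ j, ⟪μ (stdONB E i) (b j), x⟫ * ⟪μ (stdONB E i) (b j), y⟫ := by
    intro i
    rw [← LinearMap.adjoint_inner_right, ← b.sum_inner_mul_inner]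
    refine Finset.sum_congr rfl fun j _ => ?_
    rw [transp, LinearMap.adjoint_inner_left, LinearMap.adjoint_inner_right,
      real_inner_comm x]
  simp only [LinearMap.compl₁₂_apply, LinearMap.flip_apply, innerₗ_apply_apply] at h₁
  rw [← h₁, ← h₂]
  simp only [Rop, LinearMap.add_apply, LinearMap.smul_apply, LinearMap.sum_apply, inner_add_left,
    inner_smul_left, sum_inner, LinearMap.comp_apply, h₃]
  simp [transp, LinearMap.adjoint_inner_left]

/-- The Ricci form in an arbitrary orthonormal basis. -/
theorem inner_Ric {ι : Type*} [Fintype ι] [DecidableEq ι] (b : OrthonormalBasis ι ℝ E)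
    (μ : E →ₗ[ℝ] E →ₗ[ℝ] E) (x y : E) :
    ⟪Ric μ x, y⟫ = -(1 / 2) * ∑ i, ⟪μ (b i) x, μ (b i) y⟫
      + (1 / 4) * ∑ i, ∑ j, ⟪μ (b i) (b j), x⟫ * ⟪μ (b i) (b j), y⟫
      - (1 / 2) * ∑ i, ⟪b i, μ x (μ y (b i))⟫
      - (1 / 2) * ∑ i, (∑ j, ⟪b j, μ (b i) (b j)⟫) * (⟪μ (b i) x, y⟫ + ⟪x, μ (b i) y⟫) := by
  have hH : meanCurv μ = ∑ i, (∑ j, ⟪b j, μ (b i) (b j)⟫) • b i := by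
    conv_lhs => rw [← b.sum_repr' (meanCurv μ)]
    refine Finset.sum_congr rfl fun i _ => ?_
    rw [real_inner_comm, inner_meanCurv, LinearMap.trace_eq_sum_inner _ b]
  simp only [Ric, LinearMap.sub_apply, inner_sub_left, inner_Rop b, LinearMap.smul_apply,
    inner_smul_left, inner_Bop, LinearMap.trace_eq_sum_inner _ b, LinearMap.comp_apply, symPart,
    LinearMap.add_apply, transp, inner_add_left, LinearMap.adjoint_inner_left]
  rw [hH]
  simp only [map_sum, map_smul, LinearMap.sum_apply, LinearMap.smul_apply, sum_inner, inner_sum,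
    inner_smul_left, inner_smul_right, mul_add, Finset.sum_add_distrib]
  simp

end RicciFormula

section Obstruction

variable {E : Type*} [NormedAddCommGroup E] [InnerProductSpace ℝ E]

/-- A non-diagonal triangular action in an orthonormal basis obstructs the solsoliton condition. -/
theorem not_isSolsoliton_of_triangular [FiniteDimensional ℝ E] (b : OrthonormalBasis (Fin 3) ℝ E)
    (μ : E →ₗ[ℝ] E →ₗ[ℝ] E) (hself : ∀ X, μ X X = 0) {a β : ℝ} (ha : a ≠ 0) (hβ : β ≠ 0)
    (h₀₁ : μ (b 0) (b 1) = 0) (h₂₀ : μ (b 2) (b 0) = a • b 0)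
    (h₂₁ : μ (b 2) (b 1) = a • b 1 + β • b 0) : ¬ IsSolsoliton μ := by
  rintro ⟨c, D, hD, hRic⟩
  have hskew : ∀ X Y, μ X Y = -μ Y X := fun X Y => (LinearMap.IsAlt.neg hself Y X).symm
  have h₁₀ : μ (b 1) (b 0) = 0 := by rw [hskew, h₀₁, neg_zero]
  have h₀₂ : μ (b 0) (b 2) = -(a • b 0) := by rw [hskew, h₂₀]
  have h₁₂ : μ (b 1) (b 2) = -(a • b 1 + β • b 0) := by rw [hskew, h₂₁]
  have hR : ⟪Ric μ (b 0), b 1⟫ = -(a * β) := by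
    rw [inner_Ric b]
    simp [Fin.sum_univ_three, hself, h₀₁, h₁₀, h₀₂, h₂₀, h₁₂, h₂₁, inner_add_left,
      inner_add_right, inner_smul_left, inner_smul_right, b.inner_eq_ite]
    ring
  have hDR : ⟪Ric μ (b 0), b 1⟫ = ⟪b 1, D (b 0)⟫ := by
    rw [hRic]
    simp [inner_add_left, inner_smul_left, b.inner_eq_ite, real_inner_comm]
  have expand : ∀ j, D (b j)
      = ⟪b 0, D (b j)⟫ • b 0 + ⟪b 1, D (b j)⟫ • b 1 + ⟪b 2, D (b j)⟫ • b 2 := fun j => by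
    conv_lhs => rw [← b.sum_repr' (D (b j)), Fin.sum_univ_three]
  have e₀ := hD (b 2) (b 0)
  have e₁ := hD (b 2) (b 1)
  rw [h₂₀, map_smul, expand 0, expand 2] at e₀
  rw [h₂₁, map_add, map_smul, map_smul, expand 0, expand 1, expand 2] at e₁
  have f₀ := congrArg (fun z => ⟪b 0, z⟫) e₀
  have f₁ := congrArg (fun z => ⟪b 1, z⟫) e₁
  simp [hself, h₀₁, h₁₀, h₂₀, h₂₁, inner_add_right, inner_smul_right,
    b.inner_eq_ite] at f₀ f₁
  have : ⟪b 1, D (b 0)⟫ = 0 := by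
    have : β * ⟪b 1, D (b 0)⟫ = 0 := by linarith
    simpa [hβ] using this
  rw [hR, this] at hDR
  simp [ha, hβ] at hDR

theorem exists_orthonormalBasis_triangular (v : Fin 3 → E) (hv : LinearIndependent ℝ v)
    (hdim : Module.finrank ℝ E = 3) [FiniteDimensional ℝ E] :
    ∃ b : OrthonormalBasis (Fin 3) ℝ E, ∃ x y z k l w : ℝ, x ≠ 0 ∧ z ≠ 0 ∧ w ≠ 0 ∧
      v 0 = x • b 0 ∧ v 1 = y • b 0 + z • b 1 ∧ v 2 = k • b 0 + l • b 1 + w • b 2 := by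
  have hc : Module.finrank ℝ E = Fintype.card (Fin 3) := by simp [hdim]
  let b := InnerProductSpace.gramSchmidtOrthonormalBasis hc v
  have tri : ∀ i j : Fin 3, i < j → ⟪b j, v i⟫ = 0 := fun i j hij =>
    InnerProductSpace.gramSchmidtOrthonormalBasis_inv_triangular hc v hij
  have expand : ∀ i, v i = ⟪b 0, v i⟫ • b 0 + ⟪b 1, v i⟫ • b 1 + ⟪b 2, v i⟫ • b 2 := fun i => by
    conv_lhs => rw [← b.sum_repr' (v i), Fin.sum_univ_three]
  have h₀ : v 0 = ⟪b 0, v 0⟫ • b 0 := by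
    conv_lhs => rw [expand 0]
    simp [tri]
  have h₁ : v 1 = ⟪b 0, v 1⟫ • b 0 + ⟪b 1, v 1⟫ • b 1 := by
    conv_lhs => rw [expand 1]
    simp [tri]
  have hx : ⟪b 0, v 0⟫ ≠ 0 := fun h => hv.ne_zero 0 (by rw [h₀, h, zero_smul])
  rw [Fintype.linearIndependent_iff] at hv
  simp only [Fin.sum_univ_three] at hv
  have hz : ⟪b 1, v 1⟫ ≠ 0 := fun h => by
    have := hv ![⟪b 0, v 1⟫, -⟪b 0, v 0⟫, 0] (by
      rw [h₀, h₁, h]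
      simp [inner_smul_right]
      module) 1
    simp [hx] at this
  refine ⟨b, _, _, _, _, _, _, hx, hz, fun h => ?_, h₀, h₁, expand 2⟩
  generalize ⟪b 0, v 0⟫ = x at *
  generalize ⟪b 0, v 1⟫ = y at *
  generalize ⟪b 1, v 1⟫ = z at *
  have h₂ := expand 2
  generalize ⟪b 0, v 2⟫ = k at *
  generalize ⟪b 1, v 2⟫ = l at *
  have := hv ![l * y - k * z, -(l * x), x * z] (by
    rw [h₀, h₁, h₂, h]
    simp
    module) 2
  simp [hx, hz] at this

theorem not_isSolsoliton_of_jordan [FiniteDimensional ℝ E]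
    (μ : E →ₗ[ℝ] E →ₗ[ℝ] E) (hself : ∀ X, μ X X = 0) (hdim : Module.finrank ℝ E = 3)
    (v : Fin 3 → E) (hv : LinearIndependent ℝ v) (h₀₁ : μ (v 0) (v 1) = 0)
    (h₂₀ : μ (v 2) (v 0) = v 0) (h₂₁ : μ (v 2) (v 1) = v 0 + v 1) : ¬ IsSolsoliton μ := by
  obtain ⟨b, x, y, z, k, l, w, hx, hz, hw, e₀, e₁, e₂⟩ :=
    exists_orthonormalBasis_triangular v hv hdim
  have hskew : ∀ X Y, μ X Y = -μ Y X := fun X Y => (LinearMap.IsAlt.neg hself Y X).symm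
  rw [e₀, e₁] at h₀₁
  have g₀₁ : μ (b 0) (b 1) = 0 := by simpa [hself, hx, hz] using h₀₁
  have g₁₀ : μ (b 1) (b 0) = 0 := by rw [hskew, g₀₁, neg_zero]
  rw [e₀, e₂] at h₂₀
  rw [e₀, e₁, e₂] at h₂₁
  have g₂₀ : μ (b 2) (b 0) = w⁻¹ • b 0 := by
    simp [hself, g₁₀, hx] at h₂₀
    rw [eq_inv_smul_iff₀ hw, h₂₀]
  refine not_isSolsoliton_of_triangular b μ hself (a := w⁻¹) (β := x / (w * z)) (inv_ne_zero hw)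
    (by positivity) g₀₁ g₂₀ ?_
  simp [hself, g₁₀, g₀₁, g₂₀, smul_smul] at h₂₁
  linear_combination (norm := skip) (w⁻¹ * z⁻¹) • h₂₁
  match_scalars <;> field_simp <;> ring

end Obstruction

section Frames

variable {V W : Type*} [AddCommGroup V] [Module ℝ V] [AddCommGroup W] [Module ℝ W]

/-- `e` is a frame in which `e 1`, `e 2` commute and `ad (e 0)` acts on their span by
`e 1 ↦ p • e 1 + q • e 2`, `e 2 ↦ r • e 1 + s • e 2`. -/
structure IsPlaneFrame (μ : V →ₗ[ℝ] V →ₗ[ℝ] V) (e : Fin 3 → V) (p q r s : ℝ) : Prop where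
  linearIndependent : LinearIndependent ℝ e
  bracket_one_two : μ (e 1) (e 2) = 0
  bracket_zero_one : μ (e 0) (e 1) = p • e 1 + q • e 2
  bracket_zero_two : μ (e 0) (e 2) = r • e 1 + s • e 2

theorem bracket_skew {μ : V →ₗ[ℝ] V →ₗ[ℝ] V} (hself : ∀ X, μ X X = 0) (X Y : V) :
    μ X Y = -μ Y X :=
  (LinearMap.IsAlt.neg hself Y X).symm

theorem linearIndependent_fin_three {e : Fin 3 → V} :
    LinearIndependent ℝ e ↔
      ∀ x y z : ℝ, x • e 0 + y • e 1 + z • e 2 = 0 → x = 0 ∧ y = 0 ∧ z = 0 := by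
  simp only [Fintype.linearIndependent_iff, Fin.sum_univ_three]
  refine ⟨fun h x y z hxyz => ⟨h ![x, y, z] hxyz 0, h ![x, y, z] hxyz 1, h ![x, y, z] hxyz 2⟩,
    fun h g hg i => ?_⟩
  obtain ⟨h₀, h₁, h₂⟩ := h _ _ _ hg
  fin_cases i <;> assumption

theorem LinearIndependent.change_frame {e : Fin 3 → V} (he : LinearIndependent ℝ e)
    {k a b c d : ℝ} (hk : k ≠ 0) (hdet : a * d - b * c ≠ 0) :
    LinearIndependent ℝ ![k • e 0, a • e 1 + b • e 2, c • e 1 + d • e 2] := by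
  rw [linearIndependent_fin_three] at he ⊢
  intro x y z h
  obtain ⟨h₀, h₁, h₂⟩ := he (x * k) (y * a + z * c) (y * b + z * d) (by
    rw [← h]
    simp only [Matrix.cons_val]
    module)
  refine ⟨by simpa [hk] using h₀, ?_, ?_⟩
  · have : y * (a * d - b * c) = 0 := by linear_combination d * h₁ - c * h₂
    simpa [hdet] using this
  · have : z * (a * d - b * c) = 0 := by linear_combination a * h₂ - b * h₁
    simpa [hdet] using this

theorem IsPlaneFrame.exists_equiv {μ : V →ₗ[ℝ] V →ₗ[ℝ] V} {ν : W →ₗ[ℝ] W →ₗ[ℝ] W}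
    {e : Fin 3 → V} {f : Fin 3 → W} {p q r s : ℝ} (he : IsPlaneFrame μ e p q r s)
    (hf : IsPlaneFrame ν f p q r s) (hμ : ∀ X, μ X X = 0) (hν : ∀ X, ν X X = 0)
    (hV : Module.finrank ℝ V = 3) (hW : Module.finrank ℝ W = 3) :
    ∃ g : V ≃ₗ[ℝ] W, ∀ X Y, g (μ X Y) = ν (g X) (g Y) := by
  let b := basisOfLinearIndependentOfCardEqFinrank he.linearIndependent (by simp [hV])
  let b' := basisOfLinearIndependentOfCardEqFinrank hf.linearIndependent (by simp [hW])
  let g := b.equiv b' (Equiv.refl _)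
  have hg : ∀ i, g (e i) = f i := fun i => by
    have := b.equiv_apply i b' (Equiv.refl _)
    simpa [b, b'] using this
  have ⟨_, m₁₂, m₀₁, m₀₂⟩ := he
  have ⟨_, n₁₂, n₀₁, n₀₂⟩ := hf
  have m₂₁ := bracket_skew hμ (e 2) (e 1)
  have m₁₀ := bracket_skew hμ (e 1) (e 0)
  have m₂₀ := bracket_skew hμ (e 2) (e 0)
  have n₂₁ := bracket_skew hν (f 2) (f 1)
  have n₁₀ := bracket_skew hν (f 1) (f 0)
  have n₂₀ := bracket_skew hν (f 2) (f 0)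
  rw [m₁₂] at m₂₁
  rw [m₀₁] at m₁₀
  rw [m₀₂] at m₂₀
  rw [n₁₂] at n₂₁
  rw [n₀₁] at n₁₀
  rw [n₀₂] at n₂₀
  have key : μ.compr₂ g.toLinearMap = ν.compl₁₂ g.toLinearMap g.toLinearMap := by
    refine b.ext fun i => b.ext fun j => ?_
    fin_cases i <;> fin_cases j <;>
      simp [b, hg, hμ, hν, m₁₂, m₀₁, m₀₂, m₂₁, m₁₀, m₂₀, n₁₂, n₀₁, n₀₂, n₂₁, n₁₀, n₂₀]
  exact ⟨g, fun X Y => LinearMap.congr_fun₂ key X Y⟩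

theorem isPlaneFrame_r3Bracket : IsPlaneFrame r3Bracket (Pi.basisFun ℝ (Fin 3)) 1 0 1 1 where
  linearIndependent := (Pi.basisFun ℝ (Fin 3)).linearIndependent
  bracket_one_two := by ext i; fin_cases i <;> simp [r3Bracket]
  bracket_zero_one := by ext i; fin_cases i <;> simp [r3Bracket]
  bracket_zero_two := by ext i; fin_cases i <;> simp [r3Bracket]

theorem r3Bracket_self (X : Fin 3 → ℝ) : r3Bracket X X = 0 := by
  ext i; fin_cases i <;> simp [r3Bracket]

end Frames

section Model

/-- The Lie bracket on `ℝ³` whose standard basis is a plane frame with matrix `p q r s`. -/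
def planeBracket (p q r s : ℝ) : EuclideanSpace ℝ (Fin 3) →ₗ[ℝ]
    EuclideanSpace ℝ (Fin 3) →ₗ[ℝ] EuclideanSpace ℝ (Fin 3) :=
  LinearMap.mk₂ ℝ
    (fun X Y => !₂[0, p * (X 0 * Y 1 - Y 0 * X 1) + r * (X 0 * Y 2 - Y 0 * X 2),
      q * (X 0 * Y 1 - Y 0 * X 1) + s * (X 0 * Y 2 - Y 0 * X 2)])
    (by intro X X' Y; ext i; fin_cases i <;> simp <;> ring)
    (by intro c X Y; ext i; fin_cases i <;> simp <;> ring)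
    (by intro X Y Y'; ext i; fin_cases i <;> simp <;> ring)
    (by intro c X Y; ext i; fin_cases i <;> simp <;> ring)

theorem isLieBracket_planeBracket (p q r s : ℝ) : IsLieBracket (planeBracket p q r s) := by
  refine ⟨fun X => ?_, fun X Y Z => ?_⟩ <;> ext i <;> fin_cases i <;> simp [planeBracket] <;> ring

theorem isPlaneFrame_planeBracket (p q r s : ℝ) :
    IsPlaneFrame (planeBracket p q r s) (EuclideanSpace.basisFun (Fin 3) ℝ) p q r s where
  linearIndependent := (EuclideanSpace.basisFun (Fin 3) ℝ).toBasis.linearIndependent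
  bracket_one_two := by ext i; fin_cases i <;> simp [planeBracket]
  bracket_zero_one := by ext i; fin_cases i <;> simp [planeBracket]
  bracket_zero_two := by ext i; fin_cases i <;> simp [planeBracket]

/-- In an orthonormal plane frame with diagonal or conformal matrix, the Ricci operator is
diagonal. -/
theorem Ric_eq_of_orthonormal_planeFrame {E : Type*} [NormedAddCommGroup E]
    [InnerProductSpace ℝ E] [FiniteDimensional ℝ E] (b : OrthonormalBasis (Fin 3) ℝ E)
    {μ : E →ₗ[ℝ] E →ₗ[ℝ] E} (hself : ∀ X, μ X X = 0) {p q r s : ℝ}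
    (hb : IsPlaneFrame μ b p q r s) (h : (q = 0 ∧ r = 0) ∨ (s = p ∧ r = -q)) {D : E →ₗ[ℝ] E}
    {c : ℝ} (hc : c = -(p ^ 2 + s ^ 2)) (hD₀ : D (b 0) = 0)
    (hD₁ : D (b 1) = (-(p + s) * p - c) • b 1) (hD₂ : D (b 2) = (-(p + s) * s - c) • b 2) :
    Ric μ = c • LinearMap.id + D := by
  obtain ⟨-, m₁₂, m₀₁, m₀₂⟩ := hb
  have m₂₁ := bracket_skew hself (b 2) (b 1)
  have m₁₀ := bracket_skew hself (b 1) (b 0)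
  have m₂₀ := bracket_skew hself (b 2) (b 0)
  rw [m₁₂] at m₂₁
  rw [m₀₁] at m₁₀
  rw [m₀₂] at m₂₀
  refine b.toBasis.ext fun i => InnerProductSpace.ext_inner_right_basis b.toBasis fun j => ?_
  simp only [b.coe_toBasis, inner_Ric b]
  subst hc
  obtain ⟨rfl, rfl⟩ | ⟨rfl, rfl⟩ := h <;> fin_cases i <;> fin_cases j <;>
    simp [Fin.sum_univ_three, hself, m₁₂, m₀₁, m₀₂, m₂₁, m₁₀, m₂₀, hD₀, hD₁, hD₂,
      inner_add_left, inner_add_right, inner_smul_left, inner_smul_right,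
      b.inner_eq_ite, -inner_self_eq_norm_sq_to_K] <;> ring

/-- A plane frame with diagonal or conformal (hence normal) matrix gives a solsoliton. -/
theorem isSolsoliton_planeBracket {p q r s : ℝ} (h : (q = 0 ∧ r = 0) ∨ (s = p ∧ r = -q)) :
    IsSolsoliton (planeBracket p q r s) := by
  let c := -(p ^ 2 + s ^ 2)
  let D : EuclideanSpace ℝ (Fin 3) →ₗ[ℝ] EuclideanSpace ℝ (Fin 3) :=
    { toFun := fun X => !₂[0, (-(p + s) * p - c) * X 1, (-(p + s) * s - c) * X 2]
      map_add' := by intro X Y; ext i; fin_cases i <;> simp <;> ring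
      map_smul' := by intro k X; ext i; fin_cases i <;> simp <;> ring }
  refine ⟨c, D, fun X Y => ?_, Ric_eq_of_orthonormal_planeFrame (EuclideanSpace.basisFun (Fin 3) ℝ)
    (isLieBracket_planeBracket p q r s).1 (isPlaneFrame_planeBracket p q r s) h rfl ?_ ?_ ?_⟩
  · obtain ⟨rfl, rfl⟩ | ⟨rfl, rfl⟩ := h <;> ext i <;> fin_cases i <;>
      simp [planeBracket, D] <;> ring
  all_goals ext i; fin_cases i <;> simp [D]

end Model

section NormalForm

variable {V : Type*} [AddCommGroup V] [Module ℝ V] {μ : V →ₗ[ℝ] V →ₗ[ℝ] V}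

theorem IsPlaneFrame.change_frame {e : Fin 3 → V} {p q r s : ℝ}
    (he : IsPlaneFrame μ e p q r s) (hself : ∀ X, μ X X = 0) {k a b c d : ℝ} (hk : k ≠ 0)
    (hdet : a * d - b * c ≠ 0) {p' q' r' s' : ℝ}
    (h₁ : k * (a * p + b * r) = p' * a + q' * c) (h₂ : k * (a * q + b * s) = p' * b + q' * d)
    (h₃ : k * (c * p + d * r) = r' * a + s' * c) (h₄ : k * (c * q + d * s) = r' * b + s' * d) :
    IsPlaneFrame μ ![k • e 0, a • e 1 + b • e 2, c • e 1 + d • e 2] p' q' r' s' where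
  linearIndependent := he.linearIndependent.change_frame hk hdet
  bracket_one_two := by
    simp [hself, he.bracket_one_two, bracket_skew hself (e 2) (e 1)]
  bracket_zero_one := by
    simp only [Matrix.cons_val, map_smul, map_add, LinearMap.smul_apply, he.bracket_zero_one,
      he.bracket_zero_two]
    linear_combination (norm := module) h₁ • e 1 + h₂ • e 2
  bracket_zero_two := by
    simp only [Matrix.cons_val, map_smul, map_add, LinearMap.smul_apply, he.bracket_zero_one,
      he.bracket_zero_two]
    linear_combination (norm := module) h₃ • e 1 + h₄ • e 2

theorem bracketSpan_le {P Q R : Submodule ℝ V} (h : ∀ x ∈ P, ∀ y ∈ Q, μ x y ∈ R) :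
    bracketSpan μ P Q ≤ R := by
  refine Submodule.span_le.mpr ?_
  rintro _ ⟨x, hx, y, hy, rfl⟩
  exact h x hx y hy

theorem IsPlaneFrame.exists_eq_combination {e : Fin 3 → V} {p q r s : ℝ}
    (he : IsPlaneFrame μ e p q r s) (hdim : Module.finrank ℝ V = 3) (v : V) :
    ∃ x y z : ℝ, v = x • e 0 + y • e 1 + z • e 2 := by
  let b := basisOfLinearIndependentOfCardEqFinrank he.linearIndependent (by simp [hdim])
  refine ⟨b.repr v 0, b.repr v 1, b.repr v 2, ?_⟩
  conv_lhs => rw [← b.sum_repr v]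
  simp [Fin.sum_univ_three, b]

theorem IsPlaneFrame.isNilpotentOn_top {e : Fin 3 → V} {r : ℝ}
    (he : IsPlaneFrame μ e 0 0 r 0) (hself : ∀ X, μ X X = 0) (hdim : Module.finrank ℝ V = 3) :
    IsNilpotentOn μ ⊤ := by
  have ⟨_, m₁₂, m₀₁, m₀₂⟩ := he
  have m₂₁ := bracket_skew hself (e 2) (e 1)
  have m₁₀ := bracket_skew hself (e 1) (e 0)
  have m₂₀ := bracket_skew hself (e 2) (e 0)
  have h₁ : lcsOn μ ⊤ 1 ≤ ℝ ∙ e 1 := by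
    refine bracketSpan_le fun x _ y _ => ?_
    obtain ⟨x₀, x₁, x₂, rfl⟩ := he.exists_eq_combination hdim x
    obtain ⟨y₀, y₁, y₂, rfl⟩ := he.exists_eq_combination hdim y
    refine Submodule.mem_span_singleton.mpr ⟨r * (x₀ * y₂ - x₂ * y₀), ?_⟩
    simp [hself, m₁₂, m₀₁, m₀₂, m₂₁, m₁₀, m₂₀]
    module
  refine ⟨2, le_bot_iff.mp (bracketSpan_le fun x _ y hy => ?_)⟩
  obtain ⟨c, rfl⟩ := Submodule.mem_span_singleton.mp (h₁ hy)
  obtain ⟨x₀, x₁, x₂, rfl⟩ := he.exists_eq_combination hdim x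
  simp [hself, m₀₁, m₁₂, m₂₁]

theorem IsPlaneFrame.normal_form_of_companion {e : Fin 3 → V} {δ τ : ℝ}
    (he : IsPlaneFrame μ e 0 1 (-δ) τ) (hself : ∀ X, μ X X = 0)
    (hdim : Module.finrank ℝ V = 3) (hnil : ¬ IsNilpotentOn μ ⊤) :
    (∃ e' p q r s, IsPlaneFrame μ e' p q r s ∧ ((q = 0 ∧ r = 0) ∨ (s = p ∧ r = -q))) ∨
      ∃ e', IsPlaneFrame μ e' 1 0 1 1 := by
  rcases lt_trichotomy (τ ^ 2 - 4 * δ) 0 with h | h | h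
  · have hω := Real.sq_sqrt (show 0 ≤ δ - τ ^ 2 / 4 by linarith)
    have hω' := Real.sqrt_pos.mpr (show 0 < δ - τ ^ 2 / 4 by linarith)
    set ω := √(δ - τ ^ 2 / 4)
    refine Or.inl ⟨_, τ / 2, ω, -ω, τ / 2, he.change_frame hself (k := 1) (a := ω) (b := 0)
      (c := -(τ / 2)) (d := 1) one_ne_zero (by simpa using hω'.ne') ?_ ?_ ?_ ?_, Or.inr ⟨rfl, rfl⟩⟩
    all_goals first | ring1 | linear_combination hω
  · obtain rfl : δ = τ ^ 2 / 4 := by linarith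
    by_cases hτ : τ = 0
    · subst hτ
      refine absurd (IsPlaneFrame.isNilpotentOn_top (r := 1) (he.change_frame hself (k := 1) (a := 0)
        (b := 1) (c := 1) (d := 0) one_ne_zero (by simp) ?_ ?_ ?_ ?_) hself hdim) hnil
      all_goals ring
    · refine Or.inr ⟨_, he.change_frame hself (k := 2 / τ) (a := -1) (b := 2 / τ) (c := 1) (d := 0)
        (by positivity) (by simpa using hτ) ?_ ?_ ?_ ?_⟩
      all_goals field_simp
      all_goals ring
  · have hω := Real.sq_sqrt h.le
    have hω' := Real.sqrt_pos.mpr h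
    set ω := √(τ ^ 2 - 4 * δ)
    refine Or.inl ⟨_, (τ + ω) / 2, 0, 0, (τ - ω) / 2, he.change_frame hself (k := 1)
      (a := -((τ - ω) / 2)) (b := 1) (c := -((τ + ω) / 2)) (d := 1) one_ne_zero
      (fun h' => hω'.ne' (by linarith)) ?_ ?_ ?_ ?_, Or.inl ⟨rfl, rfl⟩⟩
    all_goals first | ring1 | linear_combination (-1 / 4) * hω

theorem IsPlaneFrame.normal_form {e : Fin 3 → V} {p q r s : ℝ}
    (he : IsPlaneFrame μ e p q r s) (hself : ∀ X, μ X X = 0)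
    (hdim : Module.finrank ℝ V = 3) (hnil : ¬ IsNilpotentOn μ ⊤) :
    (∃ e' p q r s, IsPlaneFrame μ e' p q r s ∧ ((q = 0 ∧ r = 0) ∨ (s = p ∧ r = -q))) ∨
      ∃ e', IsPlaneFrame μ e' 1 0 1 1 := by
  by_cases hq : q = 0
  · by_cases hr : r = 0
    · exact Or.inl ⟨e, p, q, r, s, he, Or.inl ⟨hq, hr⟩⟩
    · refine IsPlaneFrame.normal_form_of_companion (δ := p * s - q * r) (τ := p + s)
        (he.change_frame hself (k := 1) (a := 0) (b := 1) (c := r) (d := s) one_ne_zero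
          (by simpa using hr) ?_ ?_ ?_ ?_) hself hdim hnil
      all_goals ring
  · refine IsPlaneFrame.normal_form_of_companion (δ := p * s - q * r) (τ := p + s)
        (he.change_frame hself (k := 1) (a := 1) (b := 0) (c := p) (d := q) one_ne_zero
          (by simpa using hq) ?_ ?_ ?_ ?_) hself hdim hnil
    all_goals ring

theorem IsSolvableB.bracketSpan_lt_top [Nontrivial V] (h : IsSolvableB μ) :
    bracketSpan μ ⊤ ⊤ < ⊤ := by
  refine lt_top_iff_ne_top.mpr fun htop => ?_
  obtain ⟨k, hk⟩ := h
  have : ∀ n, derSeries μ n = ⊤ := fun n => by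
    induction n with
    | zero => rfl
    | succ n ih => rw [derSeries, ih, htop]
  exact top_ne_bot ((this k).symm.trans hk)

/-- A `3`-dimensional Lie algebra with a hyperplane ideal containing all brackets has a plane
frame. -/
theorem exists_isPlaneFrame_of_hyperplane (hLie : IsLieBracket μ) {e : Fin 3 → V}
    (he : LinearIndependent ℝ e) {p q r s α β : ℝ} (h₁₂ : μ (e 1) (e 2) = α • e 1 + β • e 2)
    (h₀₁ : μ (e 0) (e 1) = p • e 1 + q • e 2) (h₀₂ : μ (e 0) (e 2) = r • e 1 + s • e 2) :
    ∃ e' p q r s, IsPlaneFrame μ e' p q r s := by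
  have ⟨hself, hjac⟩ := hLie
  by_cases hαβ : α = 0 ∧ β = 0
  · obtain ⟨rfl, rfl⟩ := hαβ
    exact ⟨e, p, q, r, s, he, by simpa using h₁₂, h₀₁, h₀₂⟩
  have hN : α ^ 2 + β ^ 2 ≠ 0 := fun h =>
    hαβ ⟨by nlinarith [sq_nonneg α, sq_nonneg β], by nlinarith [sq_nonneg α, sq_nonneg β]⟩
  have h₂₁ := bracket_skew hself (e 2) (e 1)
  rw [h₁₂] at h₂₁
  have hJ := hjac (e 0) (e 1) (e 2)
  simp [hself, h₁₂, h₀₁, h₀₂] at hJ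
  rw [linearIndependent_fin_three] at he
  obtain ⟨-, j₁, j₂⟩ := he 0 (β * r - s * α) (α * q - p * β) (by
    linear_combination (norm := module) hJ)
  obtain ⟨N, hN'⟩ : ∃ N, N * (α ^ 2 + β ^ 2) = 1 := ⟨_, inv_mul_cancel₀ hN⟩
  have hN₀ : N ≠ 0 := left_ne_zero_of_mul_eq_one hN'
  let x := (N * β) • e 1 - (N * α) • e 2
  let y := α • e 1 + β • e 2
  let t := p + s
  let k := N ^ 2 * (α * (β * p - α * r) + β * (β * q - α * s))
  have hxy : μ x y = y := by
    simp [x, y, hself, h₁₂, h₂₁]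
    linear_combination (norm := module) hN' • (α • e 1 + β • e 2)
  have hy : μ (e 0) y = t • y := by
    simp [y, t, h₀₁, h₀₂]
    linear_combination (norm := module) j₁ • e 1 + j₂ • e 2
  have hx : μ (e 0) x = k • y := by
    simp [x, y, k, h₀₁, h₀₂]
    linear_combination (norm := module)
      (-(N * (β * p - α * r)) * hN' - N ^ 2 * β * (β * j₂ + α * j₁)) • e 1
        + (-(N * (β * q - α * s)) * hN' + N ^ 2 * α * (β * j₂ + α * j₁)) • e 2
  have hyx := bracket_skew hself y x
  have hy' := bracket_skew hself y (e 0)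
  rw [hxy] at hyx
  rw [hy] at hy'
  refine ⟨![x, y, e 0 - t • x + k • y], 1, 0, 0, 0, ?_, ?_, ?_, ?_⟩
  · rw [linearIndependent_fin_three]
    intro a b c h
    obtain ⟨hc, h₁, h₂⟩ := he c ((a - c * t) * (N * β) + (b + c * k) * α)
      (-((a - c * t) * (N * α)) + (b + c * k) * β) (by
        rw [← h]
        simp only [Matrix.cons_val, x, y]
        module)
    subst hc
    refine ⟨?_, ?_, rfl⟩
    · linear_combination β * h₁ - α * h₂ - a * hN'
    · linear_combination N * α * h₁ + N * β * h₂ - b * hN'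
  · simp [hself, hyx, hy']
  · simp [hxy]
  · simp [hself, hxy, bracket_skew hself x (e 0), hx]

theorem exists_isPlaneFrame [FiniteDimensional ℝ V] (hLie : IsLieBracket μ)
    (hsolv : IsSolvableB μ) (hdim : Module.finrank ℝ V = 3) :
    ∃ e p q r s, IsPlaneFrame μ e p q r s := by
  have : Nontrivial V := Module.nontrivial_of_finrank_pos (R := ℝ) (by omega)
  obtain ⟨f, hf, hle⟩ := Submodule.exists_le_ker_of_lt_top _ hsolv.bracketSpan_lt_top
  have hker : ∀ X Y, f (μ X Y) = 0 := fun X Y =>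
    hle (Submodule.subset_span ⟨X, trivial, Y, trivial, rfl⟩)
  obtain ⟨e₀, he₀⟩ : ∃ v, f v ≠ 0 := by
    by_contra! h
    exact hf (LinearMap.ext h)
  have hfin : Module.finrank ℝ (LinearMap.ker f) = 2 := by
    have := Module.Dual.finrank_ker_add_one_of_ne_zero hf
    omega
  let b := Module.finBasisOfFinrankEq ℝ (LinearMap.ker f) hfin
  have hcomb : ∀ X Y, ∃ x y : ℝ, μ X Y = x • (b 0 : V) + y • (b 1 : V) := fun X Y => by
    let z : LinearMap.ker f := ⟨μ X Y, hker X Y⟩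
    refine ⟨b.repr z 0, b.repr z 1, ?_⟩
    have := congrArg Subtype.val (b.sum_repr z)
    rw [Fin.sum_univ_two] at this
    exact this.symm
  have hli : LinearIndependent ℝ ![e₀, (b 0 : V), (b 1 : V)] := by
    rw [linearIndependent_fin_three]
    intro x y z h
    simp only [Matrix.cons_val] at h
    have hx : x = 0 := by
      have := congrArg f h
      simpa [LinearMap.mem_ker.mp (b 0).2, LinearMap.mem_ker.mp (b 1).2, he₀] using this
    subst hx
    have := Fintype.linearIndependent_iff.mp b.linearIndependent ![y, z] (by
      apply Subtype.ext
      simpa [Fin.sum_univ_two] using h)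
    exact ⟨rfl, this 0, this 1⟩
  obtain ⟨α, β, h₁₂⟩ := hcomb (b 0) (b 1)
  obtain ⟨p, q, h₀₁⟩ := hcomb e₀ (b 0)
  obtain ⟨r, s, h₀₂⟩ := hcomb e₀ (b 1)
  exact exists_isPlaneFrame_of_hyperplane hLie hli h₁₂ h₀₁ h₀₂

end NormalForm

/-- a `3`-dimensional solvable non-nilpotent real Lie algebra admits a solsoliton
inner product if and only if it is not isomorphic to `r₃` (the algebra with basis `{A, X₁, X₂}`
and nonzero brackets `[A, X₁] = X₁`, `[A, X₂] = X₁ + X₂`). -/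
theorem three_dim_solsoliton_iff_not_r3
    {V : Type*} [AddCommGroup V] [Module ℝ V] [FiniteDimensional ℝ V]
    (μ : V →ₗ[ℝ] V →ₗ[ℝ] V) (hLie : IsLieBracket μ) (hsolv : IsSolvableB μ)
    (hnotnilp : ¬ IsNilpotentOn μ ⊤) (hdim : Module.finrank ℝ V = 3) :
    (∃ (E : Type) (_i₁ : NormedAddCommGroup E) (_i₂ : InnerProductSpace ℝ E)
        (_i₃ : FiniteDimensional ℝ E) (μ' : E →ₗ[ℝ] E →ₗ[ℝ] E) (g : V ≃ₗ[ℝ] E),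
        IsLieBracket μ' ∧ (∀ X Y, g (μ X Y) = μ' (g X) (g Y)) ∧ IsSolsoliton μ') ↔
      ¬ ∃ g : V ≃ₗ[ℝ] (Fin 3 → ℝ), ∀ X Y, g (μ X Y) = r3Bracket (g X) (g Y) := by
  constructor
  · rintro ⟨E, _, _, _, μ', g, hLie', hg, hsol⟩ ⟨g', hg'⟩
    let φ : (Fin 3 → ℝ) ≃ₗ[ℝ] E := g'.symm.trans g
    have hφ : ∀ X Y, φ (r3Bracket X Y) = μ' (φ X) (φ Y) := fun X Y => by
      have : g'.symm (r3Bracket X Y) = μ (g'.symm X) (g'.symm Y) := by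
        rw [LinearEquiv.symm_apply_eq, hg', g'.apply_symm_apply, g'.apply_symm_apply]
      simp only [φ, LinearEquiv.trans_apply, this, hg]
    have ⟨_, m₁₂, m₀₁, m₀₂⟩ := isPlaneFrame_r3Bracket
    let e := Pi.basisFun ℝ (Fin 3)
    refine not_isSolsoliton_of_jordan μ' hLie'.1 (g.finrank_eq.symm.trans hdim)
      ((e.map φ) ∘ ![1, 2, 0]) ((e.map φ).linearIndependent.comp _ (by decide)) ?_ ?_ ?_ hsol
    · simpa [e, ← hφ] using congrArg φ m₁₂
    · simpa [e, ← hφ] using congrArg φ m₀₁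
    · simpa [e, ← hφ] using congrArg φ m₀₂
  · intro hr3
    obtain ⟨e, p, q, r, s, he⟩ := exists_isPlaneFrame hLie hsolv hdim
    obtain ⟨e', p, q, r, s, he', hnormal⟩ | ⟨e', he'⟩ := he.normal_form hLie.1 hdim hnotnilp
    · have hLie' := isLieBracket_planeBracket p q r s
      obtain ⟨g, hg⟩ := he'.exists_equiv (isPlaneFrame_planeBracket p q r s) hLie.1 hLie'.1 hdim
        (by simp)
      exact ⟨_, _, _, inferInstance, _, g, hLie', hg, isSolsoliton_planeBracket hnormal⟩
    · exact absurd (he'.exists_equiv isPlaneFrame_r3Bracket hLie.1 r3Bracket_self hdim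
        (by simp)) hr3
end
end
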